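/- arXiv:2205.04420 — 2 statements merged into one kernel-verified Lean document; each statement's English description precedes it below -/
import Mathlib

section
/- Let G ∈ F_2, let (G,w) be an 8-unbalanced pair, and assume G admits no star cutset. Let K_1, K_2, K_1', K_2' be cliques of G (each of size at most 2) such that the canonical two-clique-separations S = S(K_1,K_2) and S' = S(K_1',K_2') are both active in G. Then S and S' are loosely non-crossing. -/
open SimpleGraph Set List

namespace Paper

variable {V : Type} {W : Type}

/-- The closed neighborhood `N[v]` of a vertex. -/
def closedNbhd (G : SimpleGraph V) (v : V) : Set V := insert v (G.neighborSet v)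

/-- The degree of a vertex (as the number of its neighbors). -/
noncomputable def deg (G : SimpleGraph V) (v : V) : ℕ := (G.neighborSet v).ncard

/-- `G` contains `H` as an induced subgraph, i.e. some induced subgraph of `G` is
isomorphic to `H`. -/
def ContainsInduced (G : SimpleGraph V) (H : SimpleGraph W) : Prop :=
  ∃ s : Set V, Nonempty (H ≃g G.induce s)

/-- `(A, C, B)` is a separation of `G`. -/
def IsSeparation (G : SimpleGraph V) (A C B : Set V) : Prop :=
  A ∪ C ∪ B = Set.univ ∧ Disjoint A C ∧ Disjoint A B ∧ Disjoint C B ∧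
    ∀ a ∈ A, ∀ b ∈ B, ¬G.Adj a b

/-- `G` admits a star cutset. -/
def HasStarCutset (G : SimpleGraph V) : Prop :=
  ∃ A C B : Set V, IsSeparation G A C B ∧ A.Nonempty ∧ B.Nonempty ∧
    ∃ v ∈ C, C ⊆ closedNbhd G v

/-- `G` admits a clique cutset. -/
def HasCliqueCutset (G : SimpleGraph V) : Prop :=
  ∃ A C B : Set V, IsSeparation G A C B ∧ A.Nonempty ∧ B.Nonempty ∧ G.IsClique C

/-- `D` is a connected component of `G \ X`: a maximal connected subset of `Xᶜ`. -/
def IsComponentOf (G : SimpleGraph V) (X : Set V) (D : Set V) : Prop :=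
  D.Nonempty ∧ D ⊆ Xᶜ ∧ (G.induce D).Connected ∧
    ∀ D' : Set V, D ⊆ D' → D' ⊆ Xᶜ → (G.induce D').Connected → D' = D

/-- An induced path in `G` ("path" in the paper always means induced path). -/
def IsIPath (G : SimpleGraph V) {u v : V} (P : G.Walk u v) : Prop :=
  P.IsPath ∧ P.toSubgraph.IsInduced

/-- A hole: an induced cycle of length at least four. -/
def IsHole (G : SimpleGraph V) {v : V} (c : G.Walk v v) : Prop :=
  c.IsCycle ∧ 4 ≤ c.length ∧ c.toSubgraph.IsInduced

/-- `G` is sparse: for every hole and every vertex not in it, there is an edge `ab` of the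
hole containing all neighbors of the vertex in the hole. -/
def Sparse (G : SimpleGraph V) : Prop :=
  ∀ (v : V) (c : G.Walk v v), IsHole G c → ∀ x, x ∉ c.support →
    ∃ a b, c.toSubgraph.Adj a b ∧ ∀ y ∈ c.support, G.Adj x y → y = a ∨ y = b

/-- `G` contains a pyramid (necessarily as an induced subgraph). -/
def ContainsPyramid (G : SimpleGraph V) : Prop :=
  ∃ (a b₁ b₂ b₃ : V) (P₁ : G.Walk a b₁) (P₂ : G.Walk a b₂) (P₃ : G.Walk a b₃),
    G.Adj b₁ b₂ ∧ G.Adj b₂ b₃ ∧ G.Adj b₁ b₃ ∧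
    IsIPath G P₁ ∧ IsIPath G P₂ ∧ IsIPath G P₃ ∧
    1 ≤ P₁.length ∧ 1 ≤ P₂.length ∧ 1 ≤ P₃.length ∧
    ¬(P₁.length = 1 ∧ P₂.length = 1) ∧ ¬(P₁.length = 1 ∧ P₃.length = 1) ∧
    ¬(P₂.length = 1 ∧ P₃.length = 1) ∧
    (∀ p ∈ P₁.support, p ≠ a → ∀ q ∈ P₂.support, q ≠ a →
      p ≠ q ∧ (G.Adj p q → p = b₁ ∧ q = b₂)) ∧
    (∀ p ∈ P₁.support, p ≠ a → ∀ q ∈ P₃.support, q ≠ a →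
      p ≠ q ∧ (G.Adj p q → p = b₁ ∧ q = b₃)) ∧
    (∀ p ∈ P₂.support, p ≠ a → ∀ q ∈ P₃.support, q ≠ a →
      p ≠ q ∧ (G.Adj p q → p = b₂ ∧ q = b₃))

/-- `G` contains a prism (necessarily as an induced subgraph). -/
def ContainsPrism (G : SimpleGraph V) : Prop :=
  ∃ (a₁ a₂ a₃ b₁ b₂ b₃ : V) (P₁ : G.Walk a₁ b₁) (P₂ : G.Walk a₂ b₂) (P₃ : G.Walk a₃ b₃),
    G.Adj a₁ a₂ ∧ G.Adj a₂ a₃ ∧ G.Adj a₁ a₃ ∧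
    G.Adj b₁ b₂ ∧ G.Adj b₂ b₃ ∧ G.Adj b₁ b₃ ∧
    IsIPath G P₁ ∧ IsIPath G P₂ ∧ IsIPath G P₃ ∧
    1 ≤ P₁.length ∧ 1 ≤ P₂.length ∧ 1 ≤ P₃.length ∧
    (∀ p ∈ P₁.support, ∀ q ∈ P₂.support,
      p ≠ q ∧ (G.Adj p q → (p = a₁ ∧ q = a₂) ∨ (p = b₁ ∧ q = b₂))) ∧
    (∀ p ∈ P₁.support, ∀ q ∈ P₃.support,
      p ≠ q ∧ (G.Adj p q → (p = a₁ ∧ q = a₃) ∨ (p = b₁ ∧ q = b₃))) ∧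
    (∀ p ∈ P₂.support, ∀ q ∈ P₃.support,
      p ≠ q ∧ (G.Adj p q → (p = a₂ ∧ q = a₃) ∨ (p = b₂ ∧ q = b₃)))

/-- `G` is very sparse: sparse, pyramid-free and prism-free. -/
def VerySparse (G : SimpleGraph V) : Prop :=
  Sparse G ∧ ¬ContainsPyramid G ∧ ¬ContainsPrism G

/-- `G ∈ 𝓕_t`: `G` is very sparse with no clique of size at least `t+1`. -/
def MemF (t : ℕ) (G : SimpleGraph V) : Prop :=
  VerySparse G ∧ ∀ s : Set V, G.IsClique s → s.ncard ≤ t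

/-- `G` has a tree decomposition of width at most `k`. -/
def HasTreewidthAtMost (G : SimpleGraph V) (k : ℕ) : Prop :=
  ∃ (ι : Type) (T : SimpleGraph ι) (χ : ι → Finset V),
    T.IsTree ∧
    (∀ v : V, ∃ t, v ∈ χ t) ∧
    (∀ u v : V, G.Adj u v → ∃ t, u ∈ χ t ∧ v ∈ χ t) ∧
    (∀ v : V, (T.induce {t | v ∈ χ t}).Connected) ∧
    ∀ t, (χ t).card ≤ k + 1

/-- The `n`-by-`n` wall, as a brick wall graph: `n` rows of `2n` vertices each,
with horizontal path edges in each row, and vertical edges between consecutive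
rows placed alternately. -/
def Wall (n : ℕ) : SimpleGraph (Fin n × Fin (2 * n)) :=
  SimpleGraph.fromRel (fun a b =>
    (a.1 = b.1 ∧ a.2.val + 1 = b.2.val) ∨
    (a.2 = b.2 ∧ a.1.val + 1 = b.1.val ∧ (a.1.val + a.2.val) % 2 = 0))

/-- The graph obtained from `G` by subdividing the edge `uv` once (the new vertex
is `none`). -/
def subdivideEdge (G : SimpleGraph V) (u v : V) : SimpleGraph (Option V) :=
  SimpleGraph.fromRel (fun a b =>
    (∃ x y : V, a = some x ∧ b = some y ∧ G.Adj x y ∧ ¬(x = u ∧ y = v) ∧ ¬(x = v ∧ y = u)) ∨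
    (a = none ∧ (b = some u ∨ b = some v)))

/-- `IsSubdivision G H`: `G` is (isomorphic to) a graph obtained from `H` by repeatedly
subdividing edges. -/
inductive IsSubdivision : {α : Type} → SimpleGraph α → {β : Type} → SimpleGraph β → Prop where
  | base {α β : Type} {G : SimpleGraph α} {H : SimpleGraph β} :
      Nonempty (G ≃g H) → IsSubdivision G H
  | step {α β : Type} {G : SimpleGraph α} {H : SimpleGraph β} (u v : β) :
      H.Adj u v → IsSubdivision G (subdivideEdge H u v) → IsSubdivision G H

/-- `G` contains a subdivision of the `t`-by-`t` wall as an induced subgraph. -/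
def ContainsWallSubdiv (G : SimpleGraph V) (t : ℕ) : Prop :=
  ∃ (α : Type) (S : SimpleGraph α), IsSubdivision S (Wall t) ∧ ContainsInduced G S

/-- `G` contains the line graph of a subdivision of the `t`-by-`t` wall as an induced
subgraph. -/
def ContainsLineWallSubdiv (G : SimpleGraph V) (t : ℕ) : Prop :=
  ∃ (α : Type) (S : SimpleGraph α), IsSubdivision S (Wall t) ∧
    ContainsInduced G S.lineGraph

/-- `G` is `𝓣₁`-free: no vertex has two or more neighbors in a hole not containing it. -/
def T1Free (G : SimpleGraph V) : Prop :=
  ∀ (v : V) (c : G.Walk v v), IsHole G c → ∀ x, x ∉ c.support →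
    ∀ y z, y ∈ c.support → z ∈ c.support → G.Adj x y → G.Adj x z → y = z

/-- `G` is `𝓣₂`-free: no vertex has two non-adjacent neighbors in a hole not containing
it, and `G` is pyramid-free and prism-free. -/
def T2Free (G : SimpleGraph V) : Prop :=
  (∀ (v : V) (c : G.Walk v v), IsHole G c → ∀ x, x ∉ c.support →
    ∀ y z, y ∈ c.support → z ∈ c.support → G.Adj x y → G.Adj x z → y ≠ z → G.Adj y z) ∧
  ¬ContainsPyramid G ∧ ¬ContainsPrism G

/-- The weight `w(X)` of a set of vertices. -/
noncomputable def setW (w : V → ℝ) (X : Set V) : ℝ := ∑ᶠ x ∈ X, w x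

/-- `w` is a weight function on `G`: values in `[0,1]` with total weight `1`. -/
def IsWeightFn (w : V → ℝ) : Prop :=
  (∀ v, 0 ≤ w v ∧ w v ≤ 1) ∧ setW w Set.univ = 1

/-- `X` is a `(w, c)`-balanced separator. -/
def IsBalSep (G : SimpleGraph V) (w : V → ℝ) (c : ℝ) (X : Set V) : Prop :=
  ∀ D, IsComponentOf G X D → setW w D ≤ c

/-- `(G, w)` is `d`-unbalanced: `w` is a weight function and there is no
`(w, 1/2)`-balanced separator of size at most `d`. -/
def Unbalanced (G : SimpleGraph V) (w : V → ℝ) (d : ℕ) : Prop :=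
  IsWeightFn w ∧ ∀ X : Set V, X.ncard ≤ d → ¬IsBalSep G w (1 / 2 : ℝ) X

/-- `B = B(K₁,K₂)` is the (unique) component of `G ∖ (K₁ ∪ K₂)` of weight more
than `1/2`.  Then `A(K₁,K₂) = (B ∪ K₁ ∪ K₂)ᶜ` and `S(K₁,K₂) = (A, K₁ ∪ K₂, B)` is the
canonical two-clique-separation for `{K₁, K₂}`. -/
def IsCanonicalB (G : SimpleGraph V) (w : V → ℝ) (K₁ K₂ B : Set V) : Prop :=
  IsComponentOf G (K₁ ∪ K₂) B ∧ (1 / 2 : ℝ) < setW w B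

/-- The open neighborhood `N(D)` of a set of vertices. -/
def nbhdOfSet (G : SimpleGraph V) (D : Set V) : Set V :=
  {v | v ∉ D ∧ ∃ d ∈ D, G.Adj v d}

/-- The canonical two-clique-separation `S(K₁,K₂)` (with big side `B`) is proper. -/
def ProperPair (G : SimpleGraph V) (w : V → ℝ) (K₁ K₂ B : Set V) : Prop :=
  IsCanonicalB G w K₁ K₂ B ∧
  (∃ D, IsComponentOf G (K₁ ∪ K₂) D ∧ D ⊆ (B ∪ K₁ ∪ K₂)ᶜ ∧
    K₁ ∪ K₂ ⊆ nbhdOfSet G D) ∧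
  (K₁.ncard = 1 → K₂.ncard = 1 →
    ¬∃ (x y : V) (P : G.Walk x y), K₁ = {x} ∧ K₂ = {y} ∧ IsIPath G P ∧
      {v | v ∈ P.support} = (B ∪ K₁ ∪ K₂)ᶜ ∪ K₁ ∪ K₂)

/-- The canonical two-clique-separation `S(K₁,K₂)` (with big side `B`) is active,
where `K` bounds the size of the cliques considered. -/
def ActivePair (G : SimpleGraph V) (w : V → ℝ) (K : ℕ) (K₁ K₂ B : Set V) : Prop :=
  ProperPair G w K₁ K₂ B ∧
  ∀ K₁' K₂' B' : Set V, G.IsClique K₁' → G.IsClique K₂' →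
    K₁'.ncard ≤ K → K₂'.ncard ≤ K → ProperPair G w K₁' K₂' B' →
    K₁ ∪ K₂ ≠ K₁' ∪ K₂' →
      ¬(B' ∪ K₁' ∪ K₂' ⊂ B ∪ K₁ ∪ K₂) ∧
      (B' ∪ K₁' ∪ K₂' = B ∪ K₁ ∪ K₂ → B' ⊂ B)

/-- The interiors of two paths from `a` to `b` are disjoint and anticomplete. -/
def IntDisjAnti (G : SimpleGraph V) {a b : V} (P Q : G.Walk a b) : Prop :=
  ∀ x ∈ P.support, x ≠ a → x ≠ b → ∀ y ∈ Q.support, y ≠ a → y ≠ b → x ≠ y ∧ ¬G.Adj x y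

/-- `Q₁, Q₂, Q₃` form a theta (as an induced subgraph of `G`) with ends `a, b`. -/
def ThetaCfg (G : SimpleGraph V) {a b : V} (Q₁ Q₂ Q₃ : G.Walk a b) : Prop :=
  ¬G.Adj a b ∧
  IsIPath G Q₁ ∧ IsIPath G Q₂ ∧ IsIPath G Q₃ ∧
  2 ≤ Q₁.length ∧ 2 ≤ Q₂.length ∧ 2 ≤ Q₃.length ∧
  IntDisjAnti G Q₁ Q₂ ∧ IntDisjAnti G Q₁ Q₃ ∧ IntDisjAnti G Q₂ Q₃

/-- There is a theta through the seagull `a-v-u` in `G`: a theta one of whose ends is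
`a` or `u` and which contains the seagull. -/
def ThetaThroughSeagull (G : SimpleGraph V) (a v u : V) : Prop :=
  (∃ (b : V) (Q₁ Q₂ Q₃ : G.Walk a b), ThetaCfg G Q₁ Q₂ Q₃ ∧ [a, v, u] <+: Q₁.support) ∨
  (∃ (b : V) (Q₁ Q₂ Q₃ : G.Walk u b), ThetaCfg G Q₁ Q₂ Q₃ ∧ [u, v, a] <+: Q₁.support)

/-- `a-v-u` is a heavy seagull in `G`: an induced three-vertex path whose ends both
have degree at least three. -/
def HeavySeagull (G : SimpleGraph V) (a v u : V) : Prop :=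
  a ≠ u ∧ G.Adj a v ∧ G.Adj v u ∧ ¬G.Adj a u ∧ 3 ≤ deg G a ∧ 3 ≤ deg G u

end Paper

namespace Paper

section tools
variable {V : Type} {G : SimpleGraph V}

lemma conn_closed {D S : Set V} (hD : (G.induce D).Connected) {x : V} (hx : x ∈ D) (hxS : x ∈ S)
    (hcl : ∀ r ∈ S, r ∈ D → ∀ s ∈ D, G.Adj r s → s ∈ S) : D ⊆ S := by
  intro y hy
  obtain ⟨p⟩ := hD.preconnected ⟨x, hx⟩ ⟨y, hy⟩
  have key : ∀ (u v : D), (G.induce D).Walk u v → u.1 ∈ S → v.1 ∈ S := by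
    intro u v p
    induction p with
    | nil => exact id
    | cons h p ih => intro hu; exact ih (hcl _ hu (Subtype.coe_prop _) _ (Subtype.coe_prop _) h)
  exact key _ _ p hxS

lemma conn_union {D E : Set V} (hD : (G.induce D).Connected) (hE : (G.induce E).Connected)
    (h : (D ∩ E).Nonempty) : (G.induce (D ∪ E)).Connected := by
  exact induce_union_connected hD.preconnected hE.preconnected h

lemma conn_insert {D : Set V} (hD : (G.induce D).Connected) {d e : V} (hd : d ∈ D)
    (h : G.Adj d e) : (G.induce (insert e D)).Connected := by
  have h1 : (G.induce ({d, e} : Set V)).Connected := induce_pair_connected_of_adj h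
  have := conn_union hD h1 ⟨d, hd, by simp⟩
  convert this using 2 <;> (try (ext x; simp; grind)) 

lemma comp_closed {X D : Set V} (hD : IsComponentOf G X D) {d e : V} (hd : d ∈ D)
    (h : G.Adj d e) (he : e ∉ X) : e ∈ D := by
  obtain ⟨_, h1, h2, h3⟩ := hD
  have := h3 (insert e D) (Set.subset_insert _ _)
    (Set.insert_subset he h1) (conn_insert h2 hd h)
  rw [← this]; exact Set.mem_insert _ _

lemma comp_absorb {X D E : Set V} (hD : IsComponentOf G X D) (hE : (G.induce E).Connected)
    (hEX : ∀ e ∈ E, e ∉ X) {x : V} (hx : x ∈ E) (hxD : x ∈ D) : E ⊆ D :=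
  conn_closed hE hx hxD (fun _ hr _ s hs hrs => comp_closed hD hr hrs (hEX s hs))

lemma comp_exists [Finite V] {X E : Set V} (hE : (G.induce E).Connected)
    (hEX : ∀ e ∈ E, e ∉ X) : ∃ D, IsComponentOf G X D ∧ E ⊆ D := by
  obtain ⟨D, hED, hD⟩ := (Set.toFinite {D : Set V | D ⊆ Xᶜ ∧ (G.induce D).Connected}).exists_le_maximal
    (a := E) ⟨hEX, hE⟩
  refine ⟨D, ⟨?_, hD.prop.1, hD.prop.2, ?_⟩, hED⟩
  · obtain ⟨x⟩ := hD.prop.2.nonempty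
    exact ⟨x.1, x.2⟩
  · intro D' h1 h2 h3
    exact Set.Subset.antisymm (hD.le_of_ge ⟨h2, h3⟩ h1) h1

lemma comp_of_closed {X D : Set V} (hD : (G.induce D).Connected)
    (hDX : ∀ e ∈ D, e ∉ X) (hcl : ∀ d ∈ D, ∀ e, G.Adj d e → e ∉ X → e ∈ D) :
    IsComponentOf G X D := by
  obtain ⟨x⟩ := hD.nonempty
  refine ⟨⟨x.1, x.2⟩, hDX, hD, fun D' h1 h2 h3 => Set.Subset.antisymm ?_ h1⟩
  exact conn_closed h3 (h1 x.2) x.2 (fun r hr _ s hs hrs => hcl r hr s hrs (h2 hs))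

/-- induced path via indices -/
lemma ipath_iff {u v : V} (P : G.Walk u v) : IsIPath G P ↔ P.IsPath ∧
    ∀ i j, i ≤ P.length → j ≤ P.length → G.Adj (P.getVert i) (P.getVert j) → i + 1 = j ∨ j + 1 = i := by
  unfold IsIPath
  refine and_congr_right fun hP => ⟨fun h i j hi hj hij => ?_, fun h x hx y hy hxy => ?_⟩
  · have := h (P.mem_verts_toSubgraph.2 (P.getVert_mem_support i))
      (P.mem_verts_toSubgraph.2 (P.getVert_mem_support j)) hij
    obtain ⟨k, hk, hkl⟩ := P.toSubgraph_adj_iff.1 this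
    have inj := hP.getVert_injOn
    simp only [Sym2.eq_iff] at hk
    rcases hk with ⟨h1, h2⟩ | ⟨h1, h2⟩
    · have e1 := inj (by simp; omega) (by simp; omega) h1
      have e2 := inj (by simp; omega) (by simp; omega) h2
      omega
    · have e1 := inj (by simp; omega) (by simp; omega) h1
      have e2 := inj (by simp; omega) (by simp; omega) h2
      omega
  · rw [P.mem_verts_toSubgraph, Walk.mem_support_iff_exists_getVert] at hx hy
    obtain ⟨i, rfl, hi⟩ := hx
    obtain ⟨j, rfl, hj⟩ := hy
    rw [P.toSubgraph_adj_iff]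
    rcases h i j hi hj hxy with h | h
    · exact ⟨i, by rw [h], by omega⟩
    · exact ⟨j, by rw [h, Sym2.eq_swap], by omega⟩

lemma ipath_end {u v : V} {P : G.Walk u v} (hP : IsIPath G P) {x y : V} (hx : x ∈ P.support)
    (hy : y ∈ P.support) (hux : G.Adj u x) (huy : G.Adj u y) : x = y := by
  rw [ipath_iff] at hP
  rw [Walk.mem_support_iff_exists_getVert] at hx hy
  obtain ⟨i, rfl, hi⟩ := hx
  obtain ⟨j, rfl, hj⟩ := hy
  have h1 := hP.2 0 i (by omega) hi (by simpa using hux)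
  have h2 := hP.2 0 j (by omega) hj (by simpa using huy)
  congr 1; omega

lemma ipath_reverse {u v : V} {P : G.Walk u v} (hP : IsIPath G P) : IsIPath G P.reverse :=
  ⟨hP.1.reverse, by rw [Walk.toSubgraph_reverse]; exact hP.2⟩

lemma exists_ipath {S : Set V} {a b : V} (ha : a ∈ S) (hb : b ∈ S)
    (h : (G.induce S).Connected) :
    ∃ P : G.Walk a b, IsIPath G P ∧ ∀ x ∈ P.support, x ∈ S := by
  obtain ⟨p, hp, hl⟩ := (h.preconnected ⟨a, ha⟩ ⟨b, hb⟩).exists_path_of_dist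
  let f : G.induce S →g G := ⟨Subtype.val, fun h => h⟩
  have hf : Function.Injective f := Subtype.val_injective
  refine ⟨p.map f, ?_, ?_⟩
  · rw [ipath_iff]
    refine ⟨Walk.IsPath.map hf hp, ?_⟩
    have main : ∀ i j, i < j → j ≤ p.length → (G.induce S).Adj (p.getVert i) (p.getVert j) → i + 1 = j := by
      intro i j hij hj hadj
      have := dist_le ((p.take i).append (Walk.cons hadj (p.drop j)))
      simp [Walk.take_length, Walk.drop_length] at this
      omega
    intro i j hi hj hij
    simp only [Walk.length_map] at hi hj
    rw [Walk.getVert_map, Walk.getVert_map] at hij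
    have hij' : (G.induce S).Adj (p.getVert i) (p.getVert j) := hij
    rcases lt_trichotomy i j with h | h | h
    · exact Or.inl (main i j h hj hij')
    · subst h; exact absurd hij' ((G.induce S).loopless.irrefl _)
    · exact Or.inr (main j i h hi hij'.symm)
  · intro x hx
    rw [Walk.support_map, List.mem_map] at hx
    obtain ⟨y, _, rfl⟩ := hx
    exact y.2

lemma hole_contra (hs : Sparse G) {a b u : V} {X Y : Set V}
    (hab : ¬ G.Adj a b) (hne : a ≠ b) (hXY : ∀ x ∈ X, ∀ y ∈ Y, x ≠ y ∧ ¬ G.Adj x y)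
    (haX : a ∉ X) (hbX : b ∉ X) (haY : a ∉ Y) (hbY : b ∉ Y)
    (hX : (G.induce (insert a (insert b X))).Connected)
    (hY : (G.induce (insert a (insert b Y))).Connected)
    (hua : G.Adj u a) (hub : G.Adj u b) (huX : u ∉ X) (huY : u ∉ Y) : False := by
  obtain ⟨P, hP, hPX⟩ := exists_ipath (a := a) (b := b) (by simp) (by simp) hX
  obtain ⟨Q, hQ, hQY⟩ := exists_ipath (a := a) (b := b) (by simp) (by simp) hY
  have hlen : ∀ R : G.Walk a b, 2 ≤ R.length := by
    intro R
    by_contra hlt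
    have : R.length = 0 ∨ R.length = 1 := by omega
    rcases this with h | h
    · exact hne (Walk.eq_of_length_eq_zero h)
    · exact hab (Walk.adj_of_length_eq_one h)
  have hcyc : (P.append Q.reverse).IsCycle := by
    have hPp := hP.1
    have hl := hlen P
    clear hP
    cases P with
    | nil => exact absurd rfl hne
    | @cons _ p _ h P =>
      rw [Walk.cons_isPath_iff] at hPp
      have hp : p ∈ X := by
        have := hPX p (by simp)
        rcases this with rfl | rfl | h'
        · exact absurd h (G.loopless.irrefl _)
        · exact absurd h hab
        · exact h'
      have hpQ : p ∉ Q.support := by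
        intro hh
        rcases hQY p hh with rfl | rfl | h'
        · exact haX hp
        · exact hbX hp
        · exact (hXY p hp p h').1 rfl
      rw [Walk.cons_append, Walk.cons_isCycle_iff]
      constructor
      · rw [Walk.isPath_def, Walk.support_append, List.nodup_append']
        refine ⟨hPp.1.support_nodup, hQ.1.reverse.support_nodup.tail, ?_⟩
        intro x hx hx'
        have hxb : x ≠ b := by
          rintro rfl
          have := hQ.1.reverse.support_nodup
          rw [← Walk.cons_tail_support] at this
          exact (List.nodup_cons.1 this).1 hx'
        have hxQ : x ∈ Q.support := by
          have := List.mem_of_mem_tail hx'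
          simpa using this
        have hxa : x ≠ a := by rintro rfl; exact hPp.2 hx
        have h1 : x ∈ X := by
          have := hPX x (by simp [hx]); simpa [hxa, hxb] using this
        have h2 : x ∈ Y := by
          have := hQY x hxQ; simpa [hxa, hxb] using this
        exact (hXY x h1 x h2).1 rfl
      · rw [Walk.edges_append, List.mem_append]
        rintro (h1 | h1)
        · exact hPp.2 (P.fst_mem_support_of_mem_edges h1)
        · have := Q.reverse.snd_mem_support_of_mem_edges h1
          exact hpQ (by simpa using this)
  have hind : (P.append Q.reverse).toSubgraph.IsInduced := by
    intro x hx y hy hxy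
    rw [Walk.toSubgraph_append, Walk.toSubgraph_reverse] at hx hy ⊢
    rw [Subgraph.verts_sup, Set.mem_union, Walk.mem_verts_toSubgraph, Walk.mem_verts_toSubgraph] at hx hy
    rw [Subgraph.sup_adj]
    have e1 : ∀ z ∈ P.support, z ∈ Q.support ∨ z ∈ X := by
      intro z hz
      rcases hPX z hz with rfl | rfl | h
      · left; simp
      · left; simp
      · right; exact h
    have e2 : ∀ z ∈ Q.support, z ∈ P.support ∨ z ∈ Y := by
      intro z hz
      rcases hQY z hz with rfl | rfl | h
      · left; simp
      · left; simp
      · right; exact h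
    by_cases hx1 : x ∈ P.support ∧ y ∈ P.support
    · left; exact hP.2 (P.mem_verts_toSubgraph.2 hx1.1) (P.mem_verts_toSubgraph.2 hx1.2) hxy
    by_cases hx2 : x ∈ Q.support ∧ y ∈ Q.support
    · right; exact hQ.2 (Q.mem_verts_toSubgraph.2 hx2.1) (Q.mem_verts_toSubgraph.2 hx2.2) hxy
    exfalso
    have n1 := fun x hx y hy => (hXY x hx y hy).2
    have hyx := hxy.symm
    grind
  have husupp : u ∉ (P.append Q.reverse).support := by
    intro hu
    rw [Walk.mem_support_append_iff, Walk.support_reverse, List.mem_reverse] at hu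
    have h1 := hua.ne
    have h2 := hub.ne
    rcases hu with hu | hu
    · have := hPX u hu; simp [h1, h2, huX] at this
    · have := hQY u hu; simp [h1, h2, huY] at this
  obtain ⟨e, f, hef, hh⟩ := hs a _ ⟨hcyc, by have := hlen P; have := hlen Q; simp; omega, hind⟩ u husupp
  have hG := hef.adj_sub
  have h1 := hh a (by simp) hua
  have h2 := hh b (by simp) hub
  have hG' := hG.symm
  grind
end tools

section main
variable {V : Type} [Fintype V] {G : SimpleGraph V} {w : V → ℝ}

lemma weight_inter (hw : IsWeightFn w) {X Y : Set V} (hX : (1 / 2 : ℝ) < setW w X)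
    (hY : (1 / 2 : ℝ) < setW w Y) : (X ∩ Y).Nonempty := by
  by_contra hne
  have hd : Disjoint X Y := Set.disjoint_iff_inter_eq_empty.2 (Set.not_nonempty_iff_eq_empty.1 hne)
  have h1 : setW w (X ∪ Y) = setW w X + setW w Y :=
    finsum_mem_union hd (Set.toFinite _) (Set.toFinite _)
  have h2 : setW w ((X ∪ Y) ∪ (X ∪ Y)ᶜ) = setW w (X ∪ Y) + setW w (X ∪ Y)ᶜ :=
    finsum_mem_union disjoint_compl_right (Set.toFinite _) (Set.toFinite _)
  have h3 : 0 ≤ setW w (X ∪ Y)ᶜ := finsum_nonneg fun v => finsum_nonneg fun _ => (hw.1 v).1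
  rw [Set.union_compl_self, hw.2] at h2
  linarith

lemma active_contra {K₁ K₂ B : Set V} (hS : ActivePair G w 2 K₁ K₂ B) {L₁ L₂ Bc E : Set V}
    (hL₁ : G.IsClique L₁) (hL₂ : G.IsClique L₂) (hc₁ : L₁.ncard ≤ 2) (hc₂ : L₂.ncard ≤ 2)
    (hB : (G.induce Bc).Connected) (hBw : (1 / 2 : ℝ) < setW w Bc)
    (hBL : ∀ v ∈ Bc, v ∉ L₁ ∧ v ∉ L₂)
    (hBcl : ∀ v ∈ Bc, ∀ e, G.Adj v e → e ∈ Bc ∨ e ∈ L₁ ∨ e ∈ L₂)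
    (hE : (G.induce E).Connected) (hEL : ∀ v ∈ E, v ∉ L₁ ∧ v ∉ L₂ ∧ v ∉ Bc)
    (hEn : ∀ v, v ∈ L₁ ∨ v ∈ L₂ → ∃ e ∈ E, G.Adj v e)
    (hsub : ∀ v, v ∈ Bc ∨ v ∈ L₁ ∨ v ∈ L₂ → v ∈ B ∨ v ∈ K₁ ∨ v ∈ K₂)
    {x : V} (hx : x ∈ K₁ ∨ x ∈ K₂) (hxn : x ∉ Bc ∧ x ∉ L₁ ∧ x ∉ L₂) :
    ∃ (p q : V) (P : G.Walk p q), L₁ = {p} ∧ L₂ = {q} ∧ IsIPath G P ∧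
      ∀ v, v ∈ P.support ↔ v ∉ Bc := by
  by_contra hno
  have hcomp : IsComponentOf G (L₁ ∪ L₂) Bc := by
    apply comp_of_closed hB
    · intro e he; have := hBL e he; simp [this]
    · intro d hd e hde he
      have := hBcl d hd e hde
      simp only [Set.mem_union] at he; tauto
  have hprop : ProperPair G w L₁ L₂ Bc := by
    refine ⟨⟨hcomp, hBw⟩, ?_, ?_⟩
    · obtain ⟨D, hD, hED⟩ := comp_exists (X := L₁ ∪ L₂) hE (by
        intro e he; have := hEL e he; simp [this])
      refine ⟨D, hD, ?_, ?_⟩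
      · intro d hd hd'
        have hdL : d ∉ L₁ ∪ L₂ := hD.2.1 hd
        have hdB : d ∈ Bc := by
          simp only [Set.mem_union] at hd' hdL; tauto
        have := comp_absorb hcomp hD.2.2.1 (fun e he => hD.2.1 he) hd hdB
        obtain ⟨e⟩ := hE.nonempty
        exact (hEL e.1 e.2).2.2 (this (hED e.2))
      · intro v hv
        refine ⟨fun h => hD.2.1 h hv, ?_⟩
        obtain ⟨e, he, hve⟩ := hEn v hv
        exact ⟨e, hED he, hve⟩
    · intro _ _ hP
      obtain ⟨p, q, P, h1, h2, h3, h4⟩ := hP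
      refine hno ⟨p, q, P, h1, h2, h3, fun v => ?_⟩
      have h5 := Set.ext_iff.1 h4 v
      have h6 := hBL v
      simp only [Set.mem_union, Set.mem_compl_iff, Set.mem_ofPred_eq] at h5
      tauto
  have := (hS.2 L₁ L₂ Bc hL₁ hL₂ hc₁ hc₂ hprop (by
    intro heq
    have := Set.ext_iff.1 heq x
    simp only [Set.mem_union] at this; tauto)).1
  apply this
  refine ⟨?_, ?_⟩
  · intro v hv
    have := hsub v
    simp only [Set.mem_union] at hv ⊢; tauto
  · intro hh
    have := @hh x (by simp only [Set.mem_union]; tauto)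
    simp only [Set.mem_union] at this; tauto

lemma active_nbr {K₁ K₂ B : Set V} (hS : ActivePair G w 2 K₁ K₂ B)
    (hK₁ : G.IsClique K₁) (hK₂ : G.IsClique K₂) (hc₁ : K₁.ncard ≤ 2) (hc₂ : K₂.ncard ≤ 2)
    {x : V} (hx : x ∈ K₁ ∨ x ∈ K₂) : ∃ b ∈ B, G.Adj x b := by
  by_contra hno
  push Not at hno
  obtain ⟨⟨⟨hB, hw⟩, ⟨D, hD, hDB, hDn⟩, _⟩, _⟩ := id hS
  have hBK : ∀ v ∈ B, v ∉ K₁ ∧ v ∉ K₂ := by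
    intro v hv; have := hB.2.1 hv; simpa [not_or] using this
  have hDK : ∀ v ∈ D, v ∉ K₁ ∧ v ∉ K₂ ∧ v ∉ B := by
    intro v hv; have := hDB hv; simp only [Set.mem_compl_iff, Set.mem_union] at this; tauto
  have hDn' : ∀ v, v ∈ K₁ ∨ v ∈ K₂ → ∃ e ∈ D, G.Adj v e := fun v hv => (hDn hv).2
  obtain ⟨p, q, P, h1, h2, hP, hsupp⟩ := active_contra hS (L₁ := K₁ \ {x}) (L₂ := K₂ \ {x})
    (Bc := B) (E := D) (hK₁.subset Set.sdiff_subset) (hK₂.subset Set.sdiff_subset)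
    ((Set.ncard_le_ncard Set.sdiff_subset).trans hc₁) ((Set.ncard_le_ncard Set.sdiff_subset).trans hc₂)
    hB.2.2.1 hw (by grind) (by
      intro v hv e hve
      have hex : e ≠ x := by rintro rfl; exact hno v hv hve.symm
      by_cases he : e ∈ K₁ ∪ K₂
      · grind
      · exact Or.inl (comp_closed hB hv hve he))
    hD.2.2.1 (by grind) (by grind) (by grind) (x := x) hx (by grind)
  have hxs : x ∈ P.support := (hsupp x).2 (by grind)
  have hp : p ∈ K₁ \ {x} := by rw [h1]; rfl
  have hq : q ∈ K₂ \ {x} := by rw [h2]; rfl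
  rcases hx with hx | hx
  · obtain ⟨d, hd, hpd⟩ := hDn' p (Or.inl hp.1)
    have := ipath_end hP hxs ((hsupp d).2 (hDK d hd).2.2) (hK₁ hp.1 hx hp.2) hpd
    subst this
    exact (hDK _ hd).1 hx
  · obtain ⟨d, hd, hpd⟩ := hDn' q (Or.inr hq.1)
    have hP' := ipath_reverse hP
    have := ipath_end hP' (by simpa using hxs) (x := x) (y := d)
      (by simpa using (hsupp d).2 (hDK d hd).2.2) (hK₂ hq.1 hx hq.2) hpd
    subst this
    exact (hDK _ hd).2.1 hx

lemma proper_path {K₁ B D : Set V} {y z : V} (P : G.Walk y z) (hP : IsIPath G P)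
    (hy : y ∉ K₁) (hK : K₁.Nonempty) (hB : IsComponentOf G (K₁ ∪ {y}) B)
    (hD : IsComponentOf G (K₁ ∪ {y}) D) (hDB : ∀ d ∈ D, d ∉ B)
    (hDn : ∀ v, v ∈ K₁ ∨ v = y → ∃ d ∈ D, G.Adj v d) (hz : z ∈ B)
    (hDP : ∀ d ∈ D, d ∈ P.support) (hKP : ∀ v ∈ K₁, v ∈ P.support)
    (hAP : ∀ v, v ∉ B → v ∈ P.support) :
    ∃ (x : V) (Q : G.Walk x y), K₁ = {x} ∧ IsIPath G Q ∧ ∀ v, v ∈ Q.support ↔ v ∉ B := by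
  classical
  obtain ⟨hPp, hPi⟩ := (ipath_iff P).1 hP
  have inj : ∀ i j, i ≤ P.length → j ≤ P.length → P.getVert i = P.getVert j → i = j :=
    fun i j hi hj h => hPp.getVert_injOn hi hj h
  have hmem : ∀ v ∈ P.support, ∃ i, P.getVert i = v ∧ i ≤ P.length :=
    fun v hv => Walk.mem_support_iff_exists_getVert.1 hv
  have h0 : P.getVert 0 = y := P.getVert_zero
  have hDC : ∀ d ∈ D, d ∉ K₁ ∧ d ≠ y := by
    intro d hd; have := hD.2.1 hd; simp only [Set.mem_compl_iff, Set.mem_union, Set.mem_singleton_iff] at this; tauto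
  have hBC : ∀ d ∈ B, d ∉ K₁ ∧ d ≠ y := by
    intro d hd; have := hB.2.1 hd; simp only [Set.mem_compl_iff, Set.mem_union, Set.mem_singleton_iff] at this; tauto
  have hex : ∃ j, P.getVert j ∈ K₁ ∧ j ≤ P.length := by
    obtain ⟨k, hk⟩ := hK
    obtain ⟨i, rfl, hi⟩ := hmem k (hKP k hk)
    exact ⟨i, hk, hi⟩
  obtain ⟨j, ⟨hjK, hjl⟩, hmin'⟩ : ∃ j, (P.getVert j ∈ K₁ ∧ j ≤ P.length) ∧
      ∀ i < j, ¬ (P.getVert i ∈ K₁ ∧ i ≤ P.length) :=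
    ⟨Nat.find hex, Nat.find_spec hex, fun i hi => Nat.find_min hex hi⟩
  have hmin : ∀ i < j, P.getVert i ∉ K₁ := fun i hi h => hmin' i hi ⟨h, by omega⟩
  have hne0 : ∀ i, i ≤ P.length → i ≠ 0 → P.getVert i ≠ y := by
    intro i hi hi0 h; exact hi0 (inj i 0 hi (by omega) (by rw [h, h0]))
  have hj0 : j ≠ 0 := by rintro rfl; rw [h0] at hjK; exact hy hjK
  obtain ⟨d, hd, hyd⟩ := hDn y (Or.inr rfl)
  obtain ⟨i, rfl, hi⟩ := hmem d (hDP d hd)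
  have hi1 : i = 1 := by
    have := hPi 0 i (by omega) hi (by rw [h0]; exact hyd); omega
  subst hi1
  have hj1 : 1 < j := by
    have : j ≠ 1 := by rintro rfl; exact (hDC _ hd).1 hjK
    omega
  have hDsub : D ⊆ {v | ∃ i, 1 ≤ i ∧ i < j ∧ P.getVert i = v} := by
    refine conn_closed hD.2.2.1 hd ⟨1, le_rfl, hj1, rfl⟩ ?_
    rintro r ⟨i, hi1, hij, rfl⟩ hr s hs hrs
    obtain ⟨k, rfl, hk⟩ := hmem s (hDP s hs)
    have := hPi i k (by omega) hk hrs
    have hk0 : k ≠ 0 := by rintro rfl; exact (hDC _ hs).2 h0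
    have hkj : k ≠ j := by rintro rfl; exact (hDC _ hs).1 hjK
    exact ⟨k, by omega, by omega, rfl⟩
  have hK1 : ∀ k ∈ K₁, k = P.getVert j := by
    intro k hk
    obtain ⟨d, hd, hkd⟩ := hDn k (Or.inl hk)
    obtain ⟨i, hi1, hij, rfl⟩ := hDsub hd
    obtain ⟨m, rfl, hm⟩ := hmem k (hKP k hk)
    have := hPi m i hm (by omega) hkd
    have hmj : ¬ m < j := fun h => hmin m h hk
    have : m = j := by omega
    rw [this]
  have hzB : P.getVert P.length = z := P.getVert_length
  have hup : ∀ t, t ≤ P.length → j < P.length - t → P.getVert (P.length - t) ∈ B := by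
    intro t
    induction t with
    | zero => intro _ _; simpa [hzB] using hz
    | succ t ih =>
      intro ht hjt
      have h1 := ih (by omega) (by omega)
      have hadj : G.Adj (P.getVert (P.length - (t + 1))) (P.getVert (P.length - t)) := by
        have := P.adj_getVert_succ (i := P.length - (t + 1)) (by omega)
        rwa [show P.length - (t + 1) + 1 = P.length - t by omega] at this
      refine comp_closed hB h1 hadj.symm ?_
      rintro (h | h)
      · have := inj _ _ (by omega) hjl (hK1 _ h); omega
      · exact hne0 _ (by omega) (by omega) h
  have hdn : ∀ i, i + 1 < j → P.getVert (i + 1) ∈ D := by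
    intro i
    induction i with
    | zero => intro _; exact hd
    | succ i ih =>
      intro h
      refine comp_closed hD (ih (by omega)) (P.adj_getVert_succ (by omega)) ?_
      rintro (h' | h')
      · exact hmin _ h h'
      · exact hne0 _ (by omega) (by omega) h'
  refine ⟨P.getVert j, (P.take j).reverse, ?_, ?_, ?_⟩
  · ext k; exact ⟨fun hk => hK1 k hk, fun hk => by rw [Set.mem_singleton_iff.1 hk]; exact hjK⟩
  · apply ipath_reverse
    rw [ipath_iff]
    refine ⟨hPp.take j, ?_⟩
    intro i k hi hk h
    rw [Walk.take_length] at hi hk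
    rw [Walk.take_getVert, Walk.take_getVert] at h
    have := hPi _ _ (by omega) (by omega) h
    omega
  · intro v
    rw [Walk.support_reverse, List.mem_reverse, Walk.mem_support_iff_exists_getVert]
    constructor
    · rintro ⟨i, rfl, hi⟩ hvB
      rw [Walk.take_length] at hi
      rw [Walk.take_getVert, show min j i = i by omega] at hvB
      rcases Nat.eq_zero_or_pos i with rfl | hi0
      · exact (hBC _ hvB).2 h0
      · rcases Nat.lt_or_ge i j with hij | hij
        · have := hdn (i - 1) (by omega)
          rw [show i - 1 + 1 = i by omega] at this
          exact hDB _ this hvB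
        · have : i = j := by omega
          subst this
          exact (hBC _ hvB).1 hjK
    · intro hv
      obtain ⟨i, rfl, hi⟩ := hmem v (hAP v hv)
      have hij : i ≤ j := by
        by_contra hcon
        have := hup (P.length - i) (by omega) (by omega)
        rw [show P.length - (P.length - i) = i by omega] at this
        exact hv this
      refine ⟨i, ?_, ?_⟩
      · rw [Walk.take_getVert, show min j i = i by omega]
      · rw [Walk.take_length]; omega

lemma pair_cases {K : Set V} (hc : K.ncard ≤ 2) {u a v : V} (hu : u ∈ K) (ha : a ∈ K) (hv : v ∈ K)
    (hua : u ≠ a) : v = u ∨ v = a := by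
  by_contra hno
  push Not at hno
  have h3 : ({u, a, v} : Set V).ncard = 3 := Set.ncard_eq_three.2 ⟨u, a, v, hua, hno.1.symm, hno.2.symm, rfl⟩
  have : ({u, a, v} : Set V) ⊆ K := by
    rintro x (rfl | rfl | rfl) <;> assumption
  have := Set.ncard_le_ncard this (Set.toFinite _)
  omega

set_option maxHeartbeats 4000000 in
lemma crossing (hF : MemF 2 G) (hunb : Unbalanced G w 8)
    {K₁ K₂ L₁ L₂ B B' : Set V}
    (hK₁ : G.IsClique K₁) (hK₂ : G.IsClique K₂)
    (hL₁ : G.IsClique L₁) (hL₂ : G.IsClique L₂)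
    (hc₁ : K₁.ncard ≤ 2) (hc₂ : K₂.ncard ≤ 2)
    (hd₁ : L₁.ncard ≤ 2) (hd₂ : L₂.ncard ≤ 2)
    (hS : ActivePair G w 2 K₁ K₂ B) (hS' : ActivePair G w 2 L₁ L₂ B')
    (h1 : ∃ v ∈ L₁, v ∉ B ∧ v ∉ K₁ ∧ v ∉ K₂) (h2 : ∃ v ∈ L₂, v ∈ B)
    (h3 : ∃ v ∈ K₁, v ∉ B' ∧ v ∉ L₁ ∧ v ∉ L₂) (h4 : ∃ v ∈ K₂, v ∈ B') : False := by
  have hN : ∀ x, x ∈ K₁ ∨ x ∈ K₂ → ∃ b ∈ B, G.Adj x b :=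
    fun x hx => active_nbr hS hK₁ hK₂ hc₁ hc₂ hx
  have hN' : ∀ x, x ∈ L₁ ∨ x ∈ L₂ → ∃ b ∈ B', G.Adj x b :=
    fun x hx => active_nbr hS' hL₁ hL₂ hd₁ hd₂ hx
  obtain ⟨⟨⟨hB, hw⟩, ⟨D, hD, hDB, hDn⟩, hnp⟩, _⟩ := id hS
  obtain ⟨⟨⟨hB', hw'⟩, ⟨D', hD', hDB', hDn'⟩, hnp'⟩, _⟩ := id hS'
  have hBK : ∀ v ∈ B, v ∉ K₁ ∧ v ∉ K₂ := by
    intro v hv; have := hB.2.1 hv; simpa [not_or] using this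
  have hBK' : ∀ v ∈ B', v ∉ L₁ ∧ v ∉ L₂ := by
    intro v hv; have := hB'.2.1 hv; simpa [not_or] using this
  have hDK : ∀ v ∈ D, v ∉ K₁ ∧ v ∉ K₂ ∧ v ∉ B := by
    intro v hv; have := hDB hv; simp only [Set.mem_compl_iff, Set.mem_union] at this; tauto
  have hDK' : ∀ v ∈ D', v ∉ L₁ ∧ v ∉ L₂ ∧ v ∉ B' := by
    intro v hv; have := hDB' hv; simp only [Set.mem_compl_iff, Set.mem_union] at this; tauto
  have hDN : ∀ v, v ∈ K₁ ∨ v ∈ K₂ → ∃ e ∈ D, G.Adj v e := fun v hv => (hDn hv).2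
  have hDN' : ∀ v, v ∈ L₁ ∨ v ∈ L₂ → ∃ e ∈ D', G.Adj v e := fun v hv => (hDn' hv).2
  have clB : ∀ v ∈ B, ∀ e, G.Adj v e → e ∈ B ∨ e ∈ K₁ ∨ e ∈ K₂ := by
    intro v hv e hve
    by_cases he : e ∈ K₁ ∪ K₂
    · exact Or.inr he
    · exact Or.inl (comp_closed hB hv hve he)
  have clB' : ∀ v ∈ B', ∀ e, G.Adj v e → e ∈ B' ∨ e ∈ L₁ ∨ e ∈ L₂ := by
    intro v hv e hve
    by_cases he : e ∈ L₁ ∪ L₂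
    · exact Or.inr he
    · exact Or.inl (comp_closed hB' hv hve he)
  obtain ⟨l, hl, hlA⟩ := h1
  obtain ⟨z, hz, hzB⟩ := h2
  obtain ⟨k, hk, hkA⟩ := h3
  obtain ⟨y, hy, hyB⟩ := h4
  have L1B : ∀ v ∈ L₁, v ∉ B := by
    intro v hv hvB
    have hne : v ≠ l := by rintro rfl; exact hlA.1 hvB
    have := clB v hvB l (hL₁ hv hl hne)
    tauto
  have K1B : ∀ v ∈ K₁, v ∉ B' := by
    intro v hv hvB
    have hne : v ≠ k := by rintro rfl; exact hkA.1 hvB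
    have := clB' v hvB k (hK₁ hv hk hne)
    tauto
  have L2B : ∀ v ∈ L₂, v ∈ B ∨ v ∈ K₁ ∨ v ∈ K₂ := by
    intro v hv
    by_cases hne : z = v
    · left; rw [← hne]; exact hzB
    · exact clB z hzB v (hL₂ hz hv hne)
  have K2B : ∀ v ∈ K₂, v ∈ B' ∨ v ∈ L₁ ∨ v ∈ L₂ := by
    intro v hv
    by_cases hne : y = v
    · left; rw [← hne]; exact hyB
    · exact clB' y hyB v (hK₂ hy hv hne)
  have hDL2 : ∀ v ∈ D, v ∉ L₂ := by
    intro v hv hv'; have := L2B v hv'; have := hDK v hv; tauto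
  have hDK2 : ∀ v ∈ D', v ∉ K₂ := by
    intro v hv hv'; have := K2B v hv'; have := hDK' v hv; tauto
  obtain ⟨a', ha'D, ha'L⟩ : ∃ a' ∈ D, a' ∈ L₁ := by
    by_contra hno
    push Not at hno
    obtain ⟨d1, hd1, hkd1⟩ := hDN k (Or.inl hk)
    obtain ⟨d2, hd2, hyd2⟩ := hDN y (Or.inr hy)
    have h2B : d2 ∈ B' := by
      have := clB' y hyB d2 hyd2
      have := hno d2 hd2; have := hDL2 d2 hd2; tauto
    have hsub := comp_absorb hB' hD.2.2.1 (fun e he => by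
      simp only [Set.mem_union, not_or]; exact ⟨hno e he, hDL2 e he⟩) hd2 h2B
    have := clB' d1 (hsub hd1) k hkd1.symm
    tauto
  obtain ⟨a, haD, haK⟩ : ∃ a ∈ D', a ∈ K₁ := by
    by_contra hno
    push Not at hno
    obtain ⟨d1, hd1, hkd1⟩ := hDN' l (Or.inl hl)
    obtain ⟨d2, hd2, hyd2⟩ := hDN' z (Or.inr hz)
    have h2B : d2 ∈ B := by
      have := clB z hzB d2 hyd2
      have := hno d2 hd2; have := hDK2 d2 hd2; tauto
    have hsub := comp_absorb hB hD'.2.2.1 (fun e he => by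
      simp only [Set.mem_union, not_or]; exact ⟨hno e he, hDK2 e he⟩) hd2 h2B
    have := clB d1 (hsub hd1) l hkd1.symm
    tauto
  by_cases hcase : ∀ u ∈ K₁, u ∈ L₁ → u ∈ K₂ ∨ u ∈ L₂
  · -- no common vertex: the corner separation is proper
    obtain ⟨Bc, hBc, hBcw⟩ : ∃ Bc, IsComponentOf G ((K₁ ∪ K₂) ∪ (L₁ ∪ L₂)) Bc ∧
        (1 / 2 : ℝ) < setW w Bc := by
      have hcard : ((K₁ ∪ K₂) ∪ (L₁ ∪ L₂)).ncard ≤ 8 := by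
        have e1 := Set.ncard_union_le K₁ K₂
        have e2 := Set.ncard_union_le L₁ L₂
        have e3 := Set.ncard_union_le (K₁ ∪ K₂) (L₁ ∪ L₂)
        omega
      have := hunb.2 _ hcard
      unfold IsBalSep at this
      push Not at this
      exact this
    have hBcX : ∀ v ∈ Bc, v ∉ K₁ ∧ v ∉ K₂ ∧ v ∉ L₁ ∧ v ∉ L₂ := by
      intro v hv; have := hBc.2.1 hv
      simp only [Set.mem_compl_iff, Set.mem_union] at this; tauto
    have hBcB : Bc ⊆ B := by
      obtain ⟨x, hx1, hx2⟩ := weight_inter hunb.1 hBcw hw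
      exact comp_absorb hB hBc.2.2.1 (fun e he => by
        have := hBcX e he; simp only [Set.mem_union]; tauto) hx1 hx2
    have hBcB' : Bc ⊆ B' := by
      obtain ⟨x, hx1, hx2⟩ := weight_inter hunb.1 hBcw hw'
      exact comp_absorb hB' hBc.2.2.1 (fun e he => by
        have := hBcX e he; simp only [Set.mem_union]; tauto) hx1 hx2
    have hE : (G.induce (D ∪ D')).Connected := by
      obtain ⟨d, hd, had⟩ := hDN a (Or.inl haK)
      have := conn_union (conn_insert hD.2.2.1 hd had.symm) hD'.2.2.1 ⟨a, by simp, haD⟩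
      have heq : insert a D ∪ D' = D ∪ D' := by
        ext v; simp only [Set.mem_union, Set.mem_insert_iff]
        constructor
        · rintro ((rfl | h) | h) <;> tauto
        · tauto
      rwa [heq] at this
    obtain ⟨p, q, P, e1, e2, hP, hsupp⟩ := active_contra hS (L₁ := K₂) (L₂ := L₂) (Bc := Bc)
      (E := D ∪ D') hK₂ hL₂ hc₂ hd₂ hBc.2.2.1 hBcw (fun v hv => by have := hBcX v hv; tauto)
      (by
        intro v hv e hve
        have r1 := clB v (hBcB hv) e hve
        have r2 := clB' v (hBcB' hv) e hve
        by_cases he : e ∈ (K₁ ∪ K₂) ∪ (L₁ ∪ L₂)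
        · have t1 := L1B e
          have t2 := K1B e
          have t3 := hcase e
          simp only [Set.mem_union] at he
          grind
        · exact Or.inl (comp_closed hBc hv hve he)) hE
      (by
        rintro v (hv | hv)
        · exact ⟨(hDK v hv).2.1, hDL2 v hv, fun h => (hDK v hv).2.2 (hBcB h)⟩
        · exact ⟨hDK2 v hv, (hDK' v hv).2.1, fun h => (hDK' v hv).2.2 (hBcB' h)⟩)
      (by
        rintro v (hv | hv)
        · obtain ⟨e, he, hve⟩ := hDN v (Or.inr hv)
          exact ⟨e, Or.inl he, hve⟩
        · obtain ⟨e, he, hve⟩ := hDN' v (Or.inr hv)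
          exact ⟨e, Or.inr he, hve⟩)
      (by
        rintro v (hv | hv | hv)
        · exact Or.inl (hBcB hv)
        · exact Or.inr (Or.inr hv)
        · exact L2B v hv)
      (x := k) (Or.inl hk)
      (by
        refine ⟨fun h => hkA.1 (hBcB' h), fun h => ?_, hkA.2.2⟩
        have := K2B k h; tauto)
    subst e1
    subst e2
    have hyp : y = p := hy
    have hzq : z = q := hz
    subst hyp
    subst hzq
    have hyK : y ∉ K₁ := fun h => K1B y h hyB
    obtain ⟨x, Q, ex, hQ, hQs⟩ := proper_path P hP hyK ⟨a, haK⟩ hB hD (fun d hd => (hDK d hd).2.2)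
      hDN hzB (fun d hd => (hsupp d).2 fun h => (hDK d hd).2.2 (hBcB h))
      (fun v hv => (hsupp v).2 fun h => (hBcX v h).1 hv)
      (fun v hv => (hsupp v).2 fun h => hv (hBcB h))
    refine hnp (by rw [ex]; simp) (by simp) ⟨x, y, Q, ex, rfl, hQ, ?_⟩
    ext v
    have t1 := hQs v
    have t2 := hBK v
    simp only [Set.mem_union, Set.mem_compl_iff, Set.mem_ofPred_eq]
    tauto
  · push Not at hcase
    obtain ⟨u, huK, huL, huK2, huL2⟩ := hcase
    have hua : u ≠ a := by rintro rfl; exact (hDK' _ haD).1 huL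
    have hua' : u ≠ a' := by rintro rfl; exact (hDK _ ha'D).1 huK
    have haa' : a ≠ a' := by rintro rfl; exact (hDK' _ haD).1 ha'L
    have adjua := hK₁ huK haK hua
    have adjua' := hL₁ huL ha'L hua'
    have hnadj : ¬ G.Adj a a' := by
      intro hadj
      have hcl : G.IsClique {u, a, a'} := by
        simp [SimpleGraph.isClique_iff, Set.Pairwise, adjua, adjua', hadj, adjua.symm, adjua'.symm, hadj.symm]
      have := hF.2 _ hcl
      rw [Set.ncard_eq_three.2 ⟨u, a, a', hua, hua', haa', rfl⟩] at this
      omega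
    let Z : Set V := {v | ¬ ((v ∉ B ∧ v ∉ K₁ ∧ v ∉ K₂) ∧ (v ∉ B' ∧ v ∉ L₁ ∧ v ∉ L₂))}
    have hL1 : ∀ v ∈ L₁, v = u ∨ v = a' := fun v hv => pair_cases hd₁ huL ha'L hv hua'
    obtain ⟨d, hd, had⟩ := hDN a (Or.inl haK)
    have hstep : ∀ r s, (r ∉ B' ∧ r ∉ L₁ ∧ r ∉ L₂) → s ∈ D → G.Adj r s → s ≠ a' → s ∉ Z := by
      intro r s hr hs hrs hsa hsZ
      have t1 := hDK s hs
      have t2 := hDL2 s hs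
      have t3 : s ∉ B' := by
        intro h; have := clB' s h r hrs.symm; tauto
      have t4 : s ∉ L₁ := by
        intro h
        rcases hL1 s h with rfl | h
        · exact t1.1 huK
        · exact hsa h
      exact hsZ ⟨⟨t1.2.2, t1.1, t1.2.1⟩, t3, t4, t2⟩
    have haA : a ∉ B' ∧ a ∉ L₁ ∧ a ∉ L₂ := by have := hDK' a haD; tauto
    have hdZ : d ∉ Z := hstep a d haA hd had (by rintro rfl; exact hnadj had)
    obtain ⟨X, hX, hXs⟩ := comp_exists (G := G) (X := Z) (E := {d}) (by simp)
      (by simpa using hdZ)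
    have hdX : d ∈ X := hXs rfl
    have hXZ : ∀ v ∈ X, (v ∉ B ∧ v ∉ K₁ ∧ v ∉ K₂) ∧ (v ∉ B' ∧ v ∉ L₁ ∧ v ∉ L₂) := by
      intro v hv
      exact not_not.1 (hX.2.1 hv)
    obtain ⟨r, hr, hra'⟩ : ∃ r ∈ X, G.Adj r a' := by
      by_contra hno
      push Not at hno
      have hsub : D ⊆ X := conn_closed hD.2.2.1 hd hdX (fun r hr _ s hs hrs =>
        comp_closed hX hr hrs (hstep r s (hXZ r hr).2 hs hrs (by rintro rfl; exact hno r hr hrs)))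
      exact (hXZ a' (hsub ha'D)).2.2.1 ha'L
    have hXc : (G.induce (insert a (insert a' X))).Connected :=
      conn_insert (conn_insert hX.2.2.1 hr hra') (Set.mem_insert_of_mem _ hdX) had.symm
    have hYc0 := conn_union hB.2.2.1 hB'.2.2.1 (weight_inter hunb.1 hw hw')
    obtain ⟨b, hb, hab⟩ := hN a (Or.inl haK)
    obtain ⟨b', hb', hab'⟩ := hN' a' (Or.inl ha'L)
    have hYc : (G.induce (insert a (insert a' (B ∪ B')))).Connected :=
      conn_insert (conn_insert hYc0 (Or.inr hb') hab'.symm)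
        (Set.mem_insert_of_mem _ (Or.inl hb)) hab.symm
    refine hole_contra hF.1.1 hnadj haa' (X := X) (Y := B ∪ B') ?_ ?_ ?_ ?_ ?_ hXc hYc adjua adjua' ?_ ?_
    · intro x hx v hv
      have t := hXZ x hx
      constructor
      · rintro rfl
        rcases hv with hv | hv
        · exact t.1.1 hv
        · exact t.2.1 hv
      · intro hadj
        rcases hv with hv | hv
        · have := clB v hv x hadj.symm; tauto
        · have := clB' v hv x hadj.symm; tauto
    · exact fun h => (hXZ a h).1.2.1 haK
    · exact fun h => (hXZ a' h).2.2.1 ha'L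
    · rintro (h | h)
      · exact (hBK a h).1 haK
      · exact haA.1 h
    · rintro (h | h)
      · exact (hDK a' ha'D).2.2 h
      · exact (hBK' a' h).1 ha'L
    · exact fun h => (hXZ u h).1.2.1 huK
    · rintro (h | h)
      · exact (hBK u h).1 huK
      · exact (hBK' u h).1 huL

lemma proper_swap {K₁ K₂ B : Set V} (h : ProperPair G w K₁ K₂ B) : ProperPair G w K₂ K₁ B := by
  obtain ⟨⟨h1, h2⟩, ⟨D, hD, hDB, hDn⟩, h3⟩ := h
  have e : K₂ ∪ K₁ = K₁ ∪ K₂ := Set.union_comm _ _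
  have e' : B ∪ K₂ ∪ K₁ = B ∪ K₁ ∪ K₂ := Set.union_right_comm _ _ _
  refine ⟨⟨by rw [e]; exact h1, h2⟩, ⟨D, by rw [e]; exact hD, by rw [e']; exact hDB, by rw [e]; exact hDn⟩, ?_⟩
  rintro c1 c2 ⟨x, y, P, hx, hy, hP, hs⟩
  refine h3 c2 c1 ⟨y, x, P.reverse, hy, hx, ipath_reverse hP, ?_⟩
  rw [e', Set.union_right_comm] at hs
  rw [← hs]
  ext v; simp

lemma active_swap {K₁ K₂ B : Set V} (h : ActivePair G w 2 K₁ K₂ B) : ActivePair G w 2 K₂ K₁ B := by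
  have e : K₂ ∪ K₁ = K₁ ∪ K₂ := Set.union_comm _ _
  have e' : B ∪ K₂ ∪ K₁ = B ∪ K₁ ∪ K₂ := Set.union_right_comm _ _ _
  refine ⟨proper_swap h.1, ?_⟩
  rw [e, e']
  exact h.2

lemma side_eq (hunb : Unbalanced G w 8)
    {K₁ K₂ L₁ L₂ B B' : Set V}
    (hK₁ : G.IsClique K₁) (hK₂ : G.IsClique K₂)
    (hL₁ : G.IsClique L₁) (hL₂ : G.IsClique L₂)
    (hc₁ : K₁.ncard ≤ 2) (hc₂ : K₂.ncard ≤ 2)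
    (hd₁ : L₁.ncard ≤ 2) (hd₂ : L₂.ncard ≤ 2)
    (hS : ActivePair G w 2 K₁ K₂ B) (hS' : ActivePair G w 2 L₁ L₂ B')
    (h : ∀ v ∈ L₁ ∪ L₂, v ∉ B) : K₁ ∪ K₂ = L₁ ∪ L₂ := by
  by_contra hne
  obtain ⟨x, hx, hx'⟩ := weight_inter hunb.1 hS.1.1.2 hS'.1.1.2
  have hB' := hS'.1.1.1
  have hsub : B ⊆ B' := comp_absorb hB' hS.1.1.1.2.2.1 (fun e he he' => h e he' he) hx hx'
  have hsub2 : B ∪ K₁ ∪ K₂ ⊆ B' ∪ L₁ ∪ L₂ := by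
    rw [Set.union_assoc, Set.union_assoc]
    rintro v (hv | hv)
    · exact Or.inl (hsub hv)
    · obtain ⟨b, hb, hvb⟩ := active_nbr hS hK₁ hK₂ hc₁ hc₂ hv
      by_cases hvL : v ∈ L₁ ∪ L₂
      · exact Or.inr hvL
      · exact Or.inl (comp_closed hB' (hsub hb) hvb.symm hvL)
  have t1 := hS'.2 K₁ K₂ B hK₁ hK₂ hc₁ hc₂ hS.1 (Ne.symm hne)
  have t2 := hS.2 L₁ L₂ B' hL₁ hL₂ hd₁ hd₂ hS'.1 hne
  have heq : B ∪ K₁ ∪ K₂ = B' ∪ L₁ ∪ L₂ := by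
    by_contra hh
    exact t1.1 (hsub2.ssubset_of_ne hh)
  have := t2.2 heq.symm
  exact this.2 hsub

set_option maxHeartbeats 4000000 in
lemma half (hF : MemF 2 G) (hunb : Unbalanced G w 8)
    {K₁ K₂ L₁ L₂ B B' : Set V}
    (hK₁ : G.IsClique K₁) (hK₂ : G.IsClique K₂)
    (hL₁ : G.IsClique L₁) (hL₂ : G.IsClique L₂)
    (hc₁ : K₁.ncard ≤ 2) (hc₂ : K₂.ncard ≤ 2)
    (hd₁ : L₁.ncard ≤ 2) (hd₂ : L₂.ncard ≤ 2)
    (hS : ActivePair G w 2 K₁ K₂ B) (hS' : ActivePair G w 2 L₁ L₂ B') :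
    (B ∪ K₁ ∪ K₂)ᶜ ∩ (L₁ ∪ L₂) = ∅ := by
  rw [Set.eq_empty_iff_forall_notMem]
  rintro l ⟨hlA, hl⟩
  have hne : K₁ ∪ K₂ ≠ L₁ ∪ L₂ := by
    intro h
    rw [← h] at hl
    apply hlA
    rw [Set.union_assoc]; exact Or.inr hl
  obtain ⟨z, hz, hzB⟩ : ∃ z ∈ L₁ ∪ L₂, z ∈ B := by
    by_contra hno
    push Not at hno
    exact hne (side_eq hunb hK₁ hK₂ hL₁ hL₂ hc₁ hc₂ hd₁ hd₂ hS hS' hno)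
  obtain ⟨y, hy, hyB⟩ : ∃ y ∈ K₁ ∪ K₂, y ∈ B' := by
    by_contra hno
    push Not at hno
    exact hne (side_eq hunb hL₁ hL₂ hK₁ hK₂ hd₁ hd₂ hc₁ hc₂ hS' hS hno).symm
  obtain ⟨⟨⟨hB, hw⟩, _, _⟩, _⟩ := id hS
  obtain ⟨⟨⟨hB', hw'⟩, ⟨D', hD', hDB', hDn'⟩, hnp'⟩, _⟩ := id hS'
  have clB : ∀ v ∈ B, ∀ e, G.Adj v e → e ∈ B ∨ e ∈ K₁ ∨ e ∈ K₂ := by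
    intro v hv e hve
    by_cases he : e ∈ K₁ ∪ K₂
    · exact Or.inr he
    · exact Or.inl (comp_closed hB hv hve he)
  have clB' : ∀ v ∈ B', ∀ e, G.Adj v e → e ∈ B' ∨ e ∈ L₁ ∨ e ∈ L₂ := by
    intro v hv e hve
    by_cases he : e ∈ L₁ ∪ L₂
    · exact Or.inr he
    · exact Or.inl (comp_closed hB' hv hve he)
  have hlA' : l ∉ B ∧ l ∉ K₁ ∧ l ∉ K₂ := by
    simp only [Set.mem_compl_iff, Set.mem_union] at hlA; tauto
  obtain ⟨k, hk, hkD⟩ : ∃ k ∈ K₁ ∪ K₂, k ∈ D' := by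
    by_contra hno
    push Not at hno
    obtain ⟨_, d1, hd1, hld1⟩ := hDn' hl
    obtain ⟨_, d2, hd2, hzd2⟩ := hDn' hz
    have h2 : d2 ∈ B := comp_closed hB hzB hzd2 (fun h => hno d2 h hd2)
    have hsub := comp_absorb hB hD'.2.2.1 (fun e he h => hno e h he) hd2 h2
    have := clB d1 (hsub hd1) l hld1.symm
    tauto
  have hkA : k ∉ B' ∧ k ∉ L₁ ∧ k ∉ L₂ := by
    have := hDB' hkD
    simp only [Set.mem_compl_iff, Set.mem_union] at this; tauto
  have noL : ∀ L : Set V, G.IsClique L → l ∈ L → z ∈ L → False := by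
    intro L hL h1 h2
    have hne : z ≠ l := by rintro rfl; exact hlA'.1 hzB
    have := clB z hzB l (hL h2 h1 hne)
    tauto
  have noK : ∀ L : Set V, G.IsClique L → k ∈ L → y ∈ L → False := by
    intro L hL h1 h2
    have hne : y ≠ k := by rintro rfl; exact hkA.1 hyB
    have := clB' y hyB k (hL h2 h1 hne)
    tauto
  have c1 : (l ∈ L₁ ∧ z ∈ L₂) ∨ (l ∈ L₂ ∧ z ∈ L₁) := by
    have := noL L₁ hL₁; have := noL L₂ hL₂
    simp only [Set.mem_union] at hl hz; grind
  have c2 : (k ∈ K₁ ∧ y ∈ K₂) ∨ (k ∈ K₂ ∧ y ∈ K₁) := by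
    have := noK K₁ hK₁; have := noK K₂ hK₂
    simp only [Set.mem_union] at hk hy; grind
  have hlA'' : l ∉ B ∧ l ∉ K₂ ∧ l ∉ K₁ := by tauto
  have hkA'' : k ∉ B' ∧ k ∉ L₂ ∧ k ∉ L₁ := by tauto
  rcases c1 with ⟨l1, z1⟩ | ⟨l1, z1⟩ <;> rcases c2 with ⟨k1, y1⟩ | ⟨k1, y1⟩
  · exact crossing hF hunb hK₁ hK₂ hL₁ hL₂ hc₁ hc₂ hd₁ hd₂ hS hS'
      ⟨l, l1, hlA'⟩ ⟨z, z1, hzB⟩ ⟨k, k1, hkA⟩ ⟨y, y1, hyB⟩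
  · exact crossing hF hunb hK₂ hK₁ hL₁ hL₂ hc₂ hc₁ hd₁ hd₂ (active_swap hS) hS'
      ⟨l, l1, hlA''⟩ ⟨z, z1, hzB⟩ ⟨k, k1, hkA⟩ ⟨y, y1, hyB⟩
  · exact crossing hF hunb hK₁ hK₂ hL₂ hL₁ hc₁ hc₂ hd₂ hd₁ hS (active_swap hS')
      ⟨l, l1, hlA'⟩ ⟨z, z1, hzB⟩ ⟨k, k1, hkA''⟩ ⟨y, y1, hyB⟩
  · exact crossing hF hunb hK₂ hK₁ hL₂ hL₁ hc₂ hc₁ hd₂ hd₁ (active_swap hS) (active_swap hS')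
      ⟨l, l1, hlA''⟩ ⟨z, z1, hzB⟩ ⟨k, k1, hkA''⟩ ⟨y, y1, hyB⟩

end main

/-- Theorem `noncrossing2cliques`. -/
theorem statement13 {V : Type} [Fintype V] (G : SimpleGraph V) (w : V → ℝ)
    (hF : MemF 2 G) (hunb : Unbalanced G w 8) (hns : ¬HasStarCutset G)
    (K₁ K₂ K₁' K₂' : Set V)
    (hK₁ : G.IsClique K₁) (hK₂ : G.IsClique K₂)
    (hK₁' : G.IsClique K₁') (hK₂' : G.IsClique K₂')
    (hc₁ : K₁.ncard ≤ 2) (hc₂ : K₂.ncard ≤ 2)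
    (hc₁' : K₁'.ncard ≤ 2) (hc₂' : K₂'.ncard ≤ 2)
    (B B' : Set V)
    (hS : ActivePair G w 2 K₁ K₂ B) (hS' : ActivePair G w 2 K₁' K₂' B') :
    (B ∪ K₁ ∪ K₂)ᶜ ∩ (K₁' ∪ K₂') = ∅ ∧ (B' ∪ K₁' ∪ K₂')ᶜ ∩ (K₁ ∪ K₂) = ∅ := by
  exact ⟨half hF hunb hK₁ hK₂ hK₁' hK₂' hc₁ hc₂ hc₁' hc₂' hS hS',
    half hF hunb hK₁' hK₂' hK₁ hK₂ hc₁' hc₂' hc₁ hc₂ hS' hS⟩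

end Paper
end

section
/- Let G ∈ F_2, let F = a-v_1-u_1 be a seagull in G, and let T be a theta through F in G with ends a, b and paths P_1, P_2, P_3, where F ⊆ P_1. Assume T is chosen with |P_1| minimum among all thetas through F with end a in G. Let P be a path from u_1 to a vertex of (P_2 ∪ P_3)∖N[b]. Then the interior of P contains a vertex of N[b] ∪ N[v_1]. -/
open SimpleGraph Set List

namespace Paper

section
variable {V : Type} {G : SimpleGraph V}

lemma ipath_iff_s14 {u v : V} (P : G.Walk u v) : IsIPath G P ↔ P.IsPath ∧
    ∀ s ∈ P.support, ∀ t ∈ P.support, G.Adj s t → s(s, t) ∈ P.edges := by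
  simp only [IsIPath, Subgraph.IsInduced, Walk.mem_verts_toSubgraph,
    Walk.adj_toSubgraph_iff_mem_edges]

lemma path_append_iff {u v w : V} (P : G.Walk u v) (Q : G.Walk v w) :
    (P.append Q).IsPath ↔ P.IsPath ∧ Q.IsPath ∧
      ∀ s ∈ P.support, s ∈ Q.support → s = v := by
  constructor
  · intro h
    refine ⟨h.of_append_left, h.of_append_right, fun s hs ht => ?_⟩
    rw [Walk.isPath_def, Walk.support_append, List.nodup_append'] at h
    by_contra hne
    rw [Walk.mem_support_iff] at ht
    exact h.2.2 hs (ht.resolve_left hne)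
  · rintro ⟨hP, hQ, h⟩
    rw [Walk.isPath_def] at *
    rw [Walk.support_append, List.nodup_append']
    refine ⟨hP, hQ.tail, fun s hs ht => ?_⟩
    have := h s hs (List.mem_of_mem_tail ht)
    subst this
    rw [← Walk.cons_tail_support] at hQ
    exact (List.nodup_cons.1 hQ).1 ht

lemma ipath_append {u v w : V} {P : G.Walk u v} {Q : G.Walk v w}
    (hP : IsIPath G P) (hQ : IsIPath G Q)
    (h : ∀ s ∈ P.support, s ≠ v → ∀ t ∈ Q.support, t ≠ v → s ≠ t ∧ ¬ G.Adj s t) :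
    IsIPath G (P.append Q) := by
  rw [ipath_iff_s14] at *
  refine ⟨(path_append_iff P Q).2 ⟨hP.1, hQ.1, fun s hs ht => ?_⟩, ?_⟩
  · by_contra hne
    exact (h s hs hne s ht hne).1 rfl
  · intro s hs t ht hst
    rw [Walk.mem_support_append_iff] at hs ht
    rw [Walk.edges_append, List.mem_append]
    have e1 := P.end_mem_support
    have e2 := Q.start_mem_support
    by_cases h1 : s ∈ P.support ∧ t ∈ P.support
    · exact Or.inl (hP.2 s h1.1 t h1.2 hst)
    by_cases h2 : s ∈ Q.support ∧ t ∈ Q.support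
    · exact Or.inr (hQ.2 s h2.1 t h2.2 hst)
    exfalso
    have := hst.symm
    clear hP hQ
    by_cases s = v <;> by_cases t = v <;> grind

lemma ipath_of_append {u v w : V} {P : G.Walk u v} {Q : G.Walk v w}
    (h : IsIPath G (P.append Q)) : IsIPath G P ∧ IsIPath G Q ∧
    ∀ s ∈ P.support, s ≠ v → ∀ t ∈ Q.support, t ≠ v → s ≠ t ∧ ¬ G.Adj s t := by
  rw [ipath_iff_s14, path_append_iff] at h
  obtain ⟨⟨hP, hQ, hd⟩, h⟩ := h
  have key : ∀ s t, (s ∈ P.support ∨ s ∈ Q.support) → (t ∈ P.support ∨ t ∈ Q.support) →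
      G.Adj s t → s(s,t) ∈ P.edges ∨ s(s,t) ∈ Q.edges := by
    intro s t hs ht hst
    have := h s (by simpa using hs) t (by simpa using ht) hst
    simpa using this
  have a1 : ∀ s t, s(s,t) ∈ P.edges → s ∈ P.support ∧ t ∈ P.support := fun s t hh =>
    ⟨P.fst_mem_support_of_mem_edges hh, P.snd_mem_support_of_mem_edges hh⟩
  have a2 : ∀ s t, s(s,t) ∈ Q.edges → s ∈ Q.support ∧ t ∈ Q.support := fun s t hh =>
    ⟨Q.fst_mem_support_of_mem_edges hh, Q.snd_mem_support_of_mem_edges hh⟩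
  refine ⟨(ipath_iff_s14 P).2 ⟨hP, ?_⟩, (ipath_iff_s14 Q).2 ⟨hQ, ?_⟩, ?_⟩
  · intro s hs t ht hst
    rcases key s t (Or.inl hs) (Or.inl ht) hst with h1 | h1
    · exact h1
    · have := hd s hs (a2 _ _ h1).1
      have := hd t ht (a2 _ _ h1).2
      subst_vars
      exact absurd hst (G.irrefl)
  · intro s hs t ht hst
    rcases key s t (Or.inr hs) (Or.inr ht) hst with h1 | h1
    · have := hd s (a1 _ _ h1).1 hs
      have := hd t (a1 _ _ h1).2 ht
      subst_vars
      exact absurd hst (G.irrefl)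
    · exact h1
  · intro s hs hsv t ht htv
    refine ⟨by rintro rfl; exact hsv (hd _ hs ht), fun hst => ?_⟩
    rcases key s t (Or.inl hs) (Or.inr ht) hst with h1 | h1
    · exact htv (hd t (a1 _ _ h1).2 ht)
    · exact hsv (hd s hs (a2 _ _ h1).1)

lemma ipath_nil (u : V) : IsIPath G (Walk.nil : G.Walk u u) := by
  rw [ipath_iff_s14]; simp

lemma ipath_edge {u v : V} (h : G.Adj u v) : IsIPath G (Walk.cons h Walk.nil) := by
  rw [ipath_iff_s14]
  have := h.ne
  have := h.symm
  simp
  grind [SimpleGraph.irrefl]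

lemma ipath_cons {u v w : V} (h : G.Adj u v) {P : G.Walk v w} (hP : IsIPath G P)
    (hu : u ∉ P.support) (hn : ∀ s ∈ P.support, s ≠ v → ¬ G.Adj u s) :
    IsIPath G (Walk.cons h P) := by
  have := ipath_append (ipath_edge h) hP (by
    intro s hs hsv t ht htv
    have : s = u := by simpa [hsv] using hs
    subst this
    exact ⟨by rintro rfl; exact hu ht, hn t ht htv⟩)
  simpa using this

lemma ipath_of_cons {u v w : V} {h : G.Adj u v} {P : G.Walk v w}
    (hP : IsIPath G (Walk.cons h P)) : IsIPath G P ∧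
    u ∉ P.support ∧ ∀ s ∈ P.support, s ≠ v → ¬ G.Adj u s := by
  have h2 : IsIPath G ((Walk.cons h Walk.nil).append P) := by simpa using hP
  have h3 := ipath_of_append h2
  have hne := h.ne
  refine ⟨h3.2.1, fun hu => ?_, fun s hs hsv => ?_⟩
  · exact (h3.2.2 u (by simp) hne u hu hne).1 rfl
  · exact (h3.2.2 u (by simp) hne s hs hsv).2

lemma ipath_attach {x x' y : V} (W : G.Walk x' y) (hW : IsIPath G W) (hx : x ∉ W.support)
    (hn : ∃ s ∈ W.support, G.Adj x s) :
    ∃ W' : G.Walk x y, IsIPath G W' ∧ W'.length ≤ W.length + 1 ∧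
      ∀ s ∈ W'.support, s = x ∨ s ∈ W.support := by
  induction W with
  | nil =>
    obtain ⟨s, hs, hxs⟩ := hn
    simp at hs
    subst hs
    exact ⟨Walk.cons hxs Walk.nil, ipath_edge hxs, by simp, by simp⟩
  | cons h p ih =>
    have hc := ipath_of_cons hW
    by_cases h1 : ∃ s ∈ p.support, G.Adj x s
    · obtain ⟨W', h2, h3, h4⟩ := ih hc.1 (by simp at hx; tauto) h1
      refine ⟨W', h2, by simp; omega, fun s hs => ?_⟩
      rcases h4 s hs with h5 | h5
      · exact Or.inl h5
      · right; simp [h5]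
    · push Not at h1
      obtain ⟨s, hs, hxs⟩ := hn
      rw [Walk.support_cons, List.mem_cons] at hs
      rcases hs with rfl | hs
      · refine ⟨Walk.cons hxs (Walk.cons h p), ipath_cons _ hW hx ?_, by simp, by simp⟩
        intro t ht htu
        rw [Walk.support_cons, List.mem_cons] at ht
        exact h1 t (ht.resolve_left htu)
      · exact absurd hxs (h1 s hs)

lemma exists_ipath_s14 {x y : V} (W : G.Walk x y) :
    ∃ W' : G.Walk x y, IsIPath G W' ∧ W'.length ≤ W.length ∧
      ∀ s ∈ W'.support, s ∈ W.support := by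
  induction W with
  | nil => exact ⟨Walk.nil, ipath_nil _, le_rfl, by simp⟩
  | @cons x x' y h p ih =>
    obtain ⟨W', h1, h2, h3⟩ := ih
    by_cases hx : x ∈ W'.support
    · obtain ⟨A, B, rfl⟩ := Walk.mem_support_iff_exists_append.1 hx
      refine ⟨B, (ipath_of_append h1).2.1, ?_, ?_⟩
      · simp at h2 ⊢; omega
      · intro s hs
        simp
        right
        exact h3 s (by simp [hs])
    · obtain ⟨W2, h4, h5, h6⟩ := ipath_attach W' h1 hx ⟨x', W'.start_mem_support, h⟩
      refine ⟨W2, h4, by simp; omega, fun s hs => ?_⟩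
      rcases h6 s hs with h7 | h7
      · simp [h7]
      · simp [h3 s h7]

lemma exists_first {x y : V} (W : G.Walk x y) (p : V → Prop) (h : ∃ s ∈ W.support, p s) :
    ∃ (r : V) (A : G.Walk x r) (B : G.Walk r y), W = A.append B ∧ p r ∧
      ∀ s ∈ A.support, s ≠ r → ¬ p s := by
  induction W with
  | @nil x =>
    obtain ⟨s, hs, hp⟩ := h
    simp at hs
    subst hs
    exact ⟨_, Walk.nil, Walk.nil, rfl, hp, by simp⟩
  | @cons x x' y h0 q ih =>
    by_cases hx : p x
    · exact ⟨x, Walk.nil, _, rfl, hx, by simp⟩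
    · obtain ⟨s, hs, hp⟩ := h
      rw [Walk.support_cons, List.mem_cons] at hs
      have hs : s ∈ q.support := hs.resolve_left (by rintro rfl; exact hx hp)
      obtain ⟨r, A, B, h1, h2, h3⟩ := ih ⟨s, hs, hp⟩
      refine ⟨r, Walk.cons h0 A, B, by rw [h1]; rfl, h2, ?_⟩
      intro t ht htr
      rw [Walk.support_cons, List.mem_cons] at ht
      rcases ht with rfl | ht
      · exact hx
      · exact h3 t ht htr

lemma triangle_free (hF : MemF 2 G) {p q r : V} (h1 : G.Adj p q) (h2 : G.Adj p r)
    (h3 : G.Adj q r) : False := by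
  have := hF.2 {p, q, r} (by
    intro s hs t ht hst
    have := h1.symm
    have := h2.symm
    have := h3.symm
    simp at hs ht
    grind)
  have h4 : ({p, q, r} : Set V).ncard = 3 := by
    rw [Set.ncard_eq_three]
    exact ⟨p, q, r, h1.ne, h2.ne, h3.ne, rfl⟩
  omega

lemma sparse_two (hF : MemF 2 G) {u v : V} (P Q : G.Walk u v) (hP : IsIPath G P)
    (hQ : IsIPath G Q) (hPl : 2 ≤ P.length) (hQl : 2 ≤ Q.length) (hd : IntDisjAnti G P Q)
    {w s t : V} (hwP : w ∉ P.support) (hwQ : w ∉ Q.support)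
    (hs : s ∈ P.support ∨ s ∈ Q.support) (ht : t ∈ P.support ∨ t ∈ Q.support)
    (hws : G.Adj w s) (hwt : G.Adj w t) : s = t := by
  have hQ' := ipath_reverse hQ
  have hole : IsHole G (P.append Q.reverse) := by
    refine ⟨?_, by simp; omega, ?_⟩
    · cases P with
      | nil => simp at hPl
      | @cons _ p1 _ h p =>
        have hc := ipath_of_cons hP
        have huv : u ≠ v := by
          rintro rfl; exact hc.2.1 p.end_mem_support
        have hp1 : p1 ≠ v := by
          rintro rfl
          have := (Walk.isPath_iff_nil.1 hc.1.1)
          rw [← Walk.length_eq_zero_iff] at this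
          simp at hPl
          omega
        rw [Walk.cons_append, Walk.cons_isCycle_iff]
        constructor
        · rw [path_append_iff]
          refine ⟨hc.1.1, hQ'.1, fun s' hs' hsq => ?_⟩
          by_contra hne
          have hsu : s' ≠ u := by rintro rfl; exact hc.2.1 hs'
          exact (hd s' (by simp [hs']) hsu hne s' (by simpa using hsq) hsu hne).1 rfl
        · intro hmem
          rw [Walk.edges_append, List.mem_append] at hmem
          rcases hmem with hm | hm
          · exact hc.2.1 (Walk.fst_mem_support_of_mem_edges _ hm)
          · have := Walk.snd_mem_support_of_mem_edges _ hm
            exact (hd p1 (by simp) h.ne' hp1 p1 (by simpa using this) h.ne' hp1).1 rfl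
    · intro s hs t ht hst
      have hP2 := (ipath_iff_s14 P).1 hP
      have hQ2 := (ipath_iff_s14 Q).1 hQ
      rw [Walk.adj_toSubgraph_iff_mem_edges]
      simp at hs ht ⊢
      by_cases h1 : s ∈ P.support ∧ t ∈ P.support
      · exact Or.inl (hP2.2 s h1.1 t h1.2 hst)
      by_cases h2 : s ∈ Q.support ∧ t ∈ Q.support
      · exact Or.inr (hQ2.2 s h2.1 t h2.2 hst)
      exfalso
      have e1 := P.end_mem_support
      have e2 := Q.start_mem_support
      have e3 := Q.end_mem_support
      have e4 := P.start_mem_support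
      have := hst.symm
      unfold IntDisjAnti at hd
      clear hP2 hQ2 hP hQ hQ' hwP hwQ hws hwt hPl hQl
      by_cases s = v <;> by_cases t = v <;> by_cases s = u <;> by_cases t = u <;> grind
  obtain ⟨p, q, hpq, hall⟩ := hF.1.1 u _ hole w (by simp [hwP, hwQ])
  have hs' := hall s (by simpa using hs) hws
  have ht' := hall t (by simpa using ht) hwt
  have hpq' := hpq.adj_sub
  by_contra hne
  have : G.Adj s t := by
    have := hpq'.symm
    grind
  exact triangle_free hF hws hwt this


lemma len_pos {u v : V} (P : G.Walk u v) (h : u ≠ v) : 1 ≤ P.length := by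
  cases P with
  | nil => exact absurd rfl h
  | cons _ _ => simp

lemma len_two {u v : V} (P : G.Walk u v) (h : u ≠ v) (h2 : ¬ G.Adj u v) : 2 ≤ P.length := by
  cases P with
  | nil => exact absurd rfl h
  | cons h3 p =>
    cases p with
    | nil => exact absurd h3 h2
    | cons _ _ => simp

structure Setup {a b x y : V} (A : G.Walk a x) (B : G.Walk x b) (Q₂ Q₃ : G.Walk a b)
    (W : G.Walk x y) : Prop where
  nab : ¬ G.Adj a b
  i1 : IsIPath G (A.append B)
  i2 : IsIPath G Q₂
  i3 : IsIPath G Q₃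
  d12 : ∀ s, (s ∈ A.support ∨ s ∈ B.support) → s ≠ a → s ≠ b →
    ∀ t ∈ Q₂.support, t ≠ a → t ≠ b → s ≠ t ∧ ¬ G.Adj s t
  d13 : ∀ s, (s ∈ A.support ∨ s ∈ B.support) → s ≠ a → s ≠ b →
    ∀ t ∈ Q₃.support, t ≠ a → t ≠ b → s ≠ t ∧ ¬ G.Adj s t
  d23 : ∀ s ∈ Q₂.support, s ≠ a → s ≠ b →
    ∀ t ∈ Q₃.support, t ≠ a → t ≠ b → s ≠ t ∧ ¬ G.Adj s t
  xa : x ≠ a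
  xb : x ≠ b
  nax : ¬ G.Adj a x
  iW : IsIPath G W
  yb : y ≠ b
  nyb : ¬ G.Adj y b
  yQ : y ∈ Q₂.support ∨ y ∈ Q₃.support
  out : ∀ r ∈ W.support, r ≠ x → r ≠ y → r ∉ A.support ∧ r ∉ B.support ∧
    r ∉ Q₂.support ∧ r ∉ Q₃.support
  n1 : ∀ r ∈ W.support, r ≠ x → r ≠ y → ∀ t, (t ∈ A.support ∨ t ∈ B.support) →
    G.Adj r t → t = x ∨ t = y
  n2 : ∀ r ∈ W.support, r ≠ x → r ≠ y → ∀ t, (t ∈ Q₂.support ∨ t ∈ Q₃.support) →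
    G.Adj r t → t = y ∨ G.Adj t b

namespace Setup

variable {a b x y : V} {A : G.Walk a x} {B : G.Walk x b} {Q₂ Q₃ : G.Walk a b} {W : G.Walk x y}

lemma swap (S : Setup A B Q₂ Q₃ W) : Setup A B Q₃ Q₂ W :=
  ⟨S.nab, S.i1, S.i3, S.i2, S.d13, S.d12,
    fun s hs hsa hsb t ht hta htb =>
      ⟨(S.d23 t ht hta htb s hs hsa hsb).1.symm,
        fun h => (S.d23 t ht hta htb s hs hsa hsb).2 h.symm⟩,
    S.xa, S.xb, S.nax, S.iW, S.yb, S.nyb, S.yQ.symm,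
    fun r h1 h2 h3 => by have := S.out r h1 h2 h3; tauto,
    S.n1,
    fun r h1 h2 h3 t ht => S.n2 r h1 h2 h3 t ht.symm⟩

lemma aB (S : Setup A B Q₂ Q₃ W) : a ∉ B.support := fun h =>
  (((ipath_of_append S.i1).2.2) a A.start_mem_support S.xa.symm a h S.xa.symm).1 rfl

lemma bA (S : Setup A B Q₂ Q₃ W) : b ∉ A.support := fun h =>
  (((ipath_of_append S.i1).2.2) b h S.xb.symm b B.end_mem_support S.xb.symm).1 rfl

lemma ab (S : Setup A B Q₂ Q₃ W) : a ≠ b := by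
  rintro rfl; exact S.aB B.end_mem_support

lemma x2 (S : Setup A B Q₂ Q₃ W) : x ∉ Q₂.support := fun h =>
  (S.d12 x (Or.inl A.end_mem_support) S.xa S.xb x h S.xa S.xb).1 rfl

/-- only interior contacts -/
lemma xn2 (S : Setup A B Q₂ Q₃ W) {t : V} (ht : t ∈ Q₂.support) (htb : t ≠ b) :
    ¬ G.Adj x t := by
  intro h
  by_cases hta : t = a
  · subst hta; exact S.nax h.symm
  · exact (S.d12 x (Or.inl A.end_mem_support) S.xa S.xb t ht hta htb).2 h

lemma yB (S : Setup A B Q₂ Q₃ W) : y ∉ B.support := by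
  intro h
  have hya : y ≠ a := by rintro rfl; exact S.aB h
  rcases S.yQ with h2 | h2
  · exact (S.d12 y (Or.inr h) hya S.yb y h2 hya S.yb).1 rfl
  · exact (S.d13 y (Or.inr h) hya S.yb y h2 hya S.yb).1 rfl

lemma xy (S : Setup A B Q₂ Q₃ W) : x ≠ y := by
  rintro rfl; exact S.yB B.start_mem_support

lemma nxy (S : Setup A B Q₂ Q₃ W) : ¬ G.Adj x y := by
  rcases S.yQ with h | h
  · exact S.xn2 h S.yb
  · exact S.swap.xn2 h S.yb

lemma nrb (S : Setup A B Q₂ Q₃ W) {r : V} (h1 : r ∈ W.support) (h2 : r ≠ x) (h3 : r ≠ y) :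
    ¬ G.Adj r b := by
  intro h
  rcases S.n1 r h1 h2 h3 b (Or.inr B.end_mem_support) h with h4 | h4
  · exact S.xb h4.symm
  · exact S.yb h4.symm

/-- contact with the neighbour of `b` on a path -/
def Con (b x y : V) (Q : G.Walk a b) (s : V) : Prop :=
  s ≠ x ∧ s ≠ y ∧ ∃ t ∈ Q.support, G.Adj s t ∧ G.Adj t b

lemma both_aux (S : Setup A B Q₂ Q₃ W) (hF : MemF 2 G) {r : V} (W₁ : G.Walk x r)
    (W₂ : G.Walk r y) (hW : W = W₁.append W₂) (hr : Con b x y Q₂ r)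
    (hfirst : ∀ s ∈ W₁.support, s ≠ r → ¬ Con b x y Q₂ s)
    {s₀ : V} (hs₀ : s₀ ∈ W₁.support) (hc : Con b x y Q₃ s₀) : False := by
  obtain ⟨hrx, hry, t₂, ht₂, hrt, htb⟩ := hr
  obtain ⟨hsx, hsy, t₃, ht₃, hst, htb3⟩ := hc
  have hi := S.iW
  rw [hW] at hi
  obtain ⟨iW1, -, hdis⟩ := ipath_of_append hi
  have iB := (ipath_of_append S.i1).2.1
  have hsub : ∀ s ∈ W₁.support, s ∈ W.support := fun s hs => by rw [hW]; simp [hs]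
  have hy1 : ∀ s ∈ W₁.support, s ≠ y := by
    rintro s hs rfl
    exact (hdis s hs hry.symm s W₂.end_mem_support hry.symm).1 rfl
  have ht2a : t₂ ≠ a := by rintro rfl; exact S.nab htb
  have ht3a : t₃ ≠ a := by rintro rfl; exact S.nab htb3
  have ht2b : t₂ ≠ b := htb.ne
  have ht3b : t₃ ≠ b := htb3.ne
  have nW2 : ∀ s ∈ W₁.support, s ∉ Q₂.support := by
    intro s hs h
    by_cases hsx : s = x
    · subst hsx; exact S.x2 h
    · exact (S.out s (hsub s hs) hsx (hy1 s hs)).2.2.1 h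
  have nW3 : ∀ s ∈ W₁.support, s ∉ Q₃.support := by
    intro s hs h
    by_cases hsx : s = x
    · subst hsx; exact S.swap.x2 h
    · exact (S.out s (hsub s hs) hsx (hy1 s hs)).2.2.2 h
  have iP : IsIPath G (W₁.append (Walk.cons hrt Walk.nil)) := by
    apply ipath_append iW1 (ipath_edge hrt)
    intro s hs hsr t ht htr
    have : t = t₂ := by simpa [htr] using ht
    subst this
    refine ⟨by rintro rfl; exact nW2 _ hs ht₂, fun hadj => ?_⟩
    have hsx : s ≠ x := by rintro rfl; exact S.xn2 ht₂ ht2b hadj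
    exact hfirst s hs hsr ⟨hsx, hy1 s hs, t, ht₂, hadj, htb⟩
  have iQ : IsIPath G (B.append (Walk.cons htb.symm Walk.nil)) := by
    apply ipath_append iB (ipath_edge htb.symm)
    intro s hs hsb t ht htb'
    have : t = t₂ := by simpa [htb'] using ht
    subst this
    exact S.d12 s (Or.inr hs) (by rintro rfl; exact S.aB hs) hsb t ht₂ ht2a ht2b
  have l1 := len_pos W₁ hrx.symm
  have l2 := len_pos B S.xb
  have heq := sparse_two hF _ _ iP iQ (by simp; omega) (by simp; omega) (by
      intro s hs hsx hst t ht htx htt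
      have hs : s ∈ W₁.support := by
        simp at hs
        rcases hs with h | h | h
        · exact h
        · subst h; simp
        · exact absurd h hst
      have ht : t ∈ B.support := by
        simp at ht
        rcases ht with h | h | h
        · exact h
        · subst h; simp
        · exact absurd h htt
      have hsy := hy1 s hs
      refine ⟨?_, fun hadj => ?_⟩
      · rintro rfl
        exact (S.out s (hsub s hs) hsx hsy).2.1 ht
      · rcases S.n1 s (hsub s hs) hsx hsy t (Or.inr ht) hadj with h | h
        · exact htx h
        · subst h; exact S.yB ht)
    (w := t₃) (s := s₀) (t := b) (by
      intro h
      simp at h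
      rcases h with h | h | h
      · exact nW3 _ h ht₃
      · subst h; exact nW3 _ W₁.end_mem_support ht₃
      · exact (S.d23 t₂ ht₂ ht2a ht2b t₃ ht₃ ht3a ht3b).1 h.symm) (by
      intro h
      simp at h
      rcases h with h | h | h
      · exact (S.d13 t₃ (Or.inr h) ht3a ht3b t₃ ht₃ ht3a ht3b).1 rfl
      · exact ht3b h
      · exact (S.d23 t₂ ht₂ ht2a ht2b t₃ ht₃ ht3a ht3b).1 h.symm)
    (by simp [hs₀]) (by simp) hst.symm htb3
  subst heq
  exact (S.out _ (hsub _ hs₀) hsx hsy).2.1 B.end_mem_support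

lemma both (S : Setup A B Q₂ Q₃ W) (hF : MemF 2 G) {s t : V} (hs : s ∈ W.support)
    (ht : t ∈ W.support) (h2 : Con b x y Q₂ s) (h3 : Con b x y Q₃ t) : False := by
  obtain ⟨r, W₁, W₂, hW, hr, hf⟩ := exists_first W (Con b x y Q₂) ⟨s, hs, h2⟩
  by_cases hex : ∃ s₀ ∈ W₁.support, Con b x y Q₃ s₀
  · obtain ⟨s₀, h4, h5⟩ := hex
    exact S.both_aux hF W₁ W₂ hW hr hf h4 h5
  · push Not at hex
    have ht' : t ∈ W₂.support := by
      rw [hW] at ht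
      simp at ht
      exact ht.resolve_left (fun h => hex t h h3)
    obtain ⟨q, W₃, W₄, hW2, hq, hf2⟩ := exists_first W₂ (Con b x y Q₃) ⟨t, ht', h3⟩
    refine S.swap.both_aux hF (W₁.append W₃) W₄ ?_ hq ?_ (s₀ := r) (by simp) hr
    · rw [hW, hW2, Walk.append_assoc]
    · intro s hs hsq
      simp at hs
      rcases hs with h | h
      · exact hex s h
      · exact hf2 s h hsq

/-- if `y` is on `Q₂` and differs from `a`, there is no contact on `Q₃` -/
lemma no3 (S : Setup A B Q₂ Q₃ W) (hF : MemF 2 G) (hy : y ∈ Q₂.support) (hya : y ≠ a)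
    {s : V} (hs : s ∈ W.support) (h3 : Con b x y Q₃ s) : False := by
  have hno2 : ∀ t ∈ W.support, ¬ Con b x y Q₂ t := fun t ht h2 => S.both hF ht hs h2 h3
  obtain ⟨hsx, hsy, t₃, ht₃, hst, htb3⟩ := h3
  obtain ⟨C, D, hCD⟩ := Walk.mem_support_iff_exists_append.1 hy
  have i2 := S.i2
  rw [hCD] at i2
  obtain ⟨iC, iD, hdis⟩ := ipath_of_append i2
  have iB := (ipath_of_append S.i1).2.1
  have hD : ∀ s ∈ D.support, s ∈ Q₂.support := fun s hs => by rw [hCD]; simp [hs]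
  have aD : a ∉ D.support := fun h =>
    (hdis a C.start_mem_support hya.symm a h hya.symm).1 rfl
  have ht3a : t₃ ≠ a := by rintro rfl; exact S.nab htb3
  have ht3b : t₃ ≠ b := htb3.ne
  have iQ : IsIPath G (B.append D.reverse) := by
    apply ipath_append iB (ipath_reverse iD)
    intro p hp hpb q hq hqb
    simp at hq
    exact S.d12 p (Or.inr hp) (by rintro rfl; exact S.aB hp) hpb q (hD q hq)
      (by rintro rfl; exact aD hq) hqb
  have heq := sparse_two hF W (B.append D.reverse) S.iW iQ (len_two _ S.xy S.nxy)
    (len_two _ S.xy S.nxy) (by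
      intro p hp hpx hpy q hq hqx hqy
      have ho := S.out p hp hpx hpy
      simp at hq
      refine ⟨?_, fun hadj => ?_⟩
      · rintro rfl
        rcases hq with h | h
        · exact ho.2.1 h
        · exact ho.2.2.1 (hD _ h)
      · rcases hq with h | h
        · rcases S.n1 p hp hpx hpy q (Or.inr h) hadj with h' | h'
          · exact hqx h'
          · exact hqy h'
        · rcases S.n2 p hp hpx hpy q (Or.inl (hD _ h)) hadj with h' | h'
          · exact hqy h'
          · exact hno2 p hp ⟨hpx, hpy, q, hD _ h, hadj, h'⟩)
    (w := t₃) (s := s) (t := b) (by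
      intro h
      by_cases h1 : t₃ = x
      · subst h1; exact S.swap.x2 ht₃
      by_cases h2 : t₃ = y
      · subst h2; exact S.nyb htb3
      exact (S.out t₃ h h1 h2).2.2.2 ht₃) (by
      intro h
      simp at h
      rcases h with h | h
      · exact (S.d13 t₃ (Or.inr h) ht3a ht3b t₃ ht₃ ht3a ht3b).1 rfl
      · exact (S.d23 t₃ (hD _ h) ht3a ht3b t₃ ht₃ ht3a ht3b).1 rfl)
    (Or.inl hs) (by simp) hst.symm htb3
  subst heq
  exact (S.out _ hs hsx hsy).2.1 B.end_mem_support

lemma theta (S : Setup A B Q₂ Q₃ W) (hy : y ∈ Q₂.support)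
    (hno : ∀ s ∈ W.support, ¬ Con b x y Q₃ s) :
    ∃ R₂ R₃ : G.Walk a x, ThetaCfg G A R₂ R₃ := by
  obtain ⟨C, D, hCD⟩ := Walk.mem_support_iff_exists_append.1 hy
  have i2 := S.i2
  rw [hCD] at i2
  obtain ⟨iC, iD, hdis⟩ := ipath_of_append i2
  obtain ⟨iA, iB, hdAB⟩ := ipath_of_append S.i1
  have hC : ∀ s ∈ C.support, s ∈ Q₂.support := fun s hs => by rw [hCD]; simp [hs]
  have bC : b ∉ C.support := fun h =>
    (hdis b h S.yb.symm b D.end_mem_support S.yb.symm).1 rfl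
  have nCb : ∀ s ∈ C.support, ¬ G.Adj s b := by
    intro s hs h
    by_cases hsy : s = y
    · subst hsy; exact S.nyb h
    · exact (hdis s hs hsy b D.end_mem_support S.yb.symm).2 h
  have yQ3 : y ∈ Q₃.support → y = a := fun h => by
    by_contra hya
    exact (S.d23 y hy hya S.yb y h hya S.yb).1 rfl
  -- interior of A versus W
  have yA : y ∈ A.support → y = a := fun h => by
    by_contra hya
    exact (S.d12 y (Or.inl h) hya S.yb y hy hya S.yb).1 rfl
  refine ⟨C.append W.reverse, Q₃.append B.reverse, S.nax, iA, ?_, ?_, len_two _ S.xa.symm S.nax,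
    len_two _ S.xa.symm S.nax, len_two _ S.xa.symm S.nax, ?_, ?_, ?_⟩
  · apply ipath_append iC (ipath_reverse S.iW)
    intro s hs hsy t ht hty
    simp at ht
    have hsb : s ≠ b := by rintro rfl; exact bC hs
    by_cases htx : t = x
    · subst htx
      refine ⟨by rintro rfl; exact S.x2 (hC _ hs), fun h => S.xn2 (hC _ hs) hsb h.symm⟩
    · have ho := S.out t ht htx hty
      refine ⟨by rintro rfl; exact ho.2.2.1 (hC _ hs), fun h => ?_⟩
      rcases S.n2 t ht htx hty s (Or.inl (hC _ hs)) h.symm with h' | h'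
      · exact hsy h'
      · exact nCb s hs h'
  · apply ipath_append S.i3 (ipath_reverse iB)
    intro s hs hsb t ht htb
    simp at ht
    have hta : t ≠ a := by rintro rfl; exact S.aB ht
    by_cases hsa : s = a
    · subst hsa
      refine ⟨hta.symm, fun h => ?_⟩
      by_cases htx : t = x
      · subst htx; exact S.nax h
      · exact (hdAB s A.start_mem_support S.xa.symm t ht htx).2 h
    · have := S.d13 t (Or.inr ht) hta htb s hs hsa hsb
      exact ⟨this.1.symm, fun h => this.2 h.symm⟩
  · intro s hs hsa hsx t ht hta htx
    have hsb : s ≠ b := by rintro rfl; exact S.bA hs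
    simp at ht
    rcases ht with ht | ht
    · exact S.d12 s (Or.inl hs) hsa hsb t (hC _ ht) hta (by rintro rfl; exact bC ht)
    · by_cases hty : t = y
      · subst hty
        exact S.d12 s (Or.inl hs) hsa hsb t hy hta S.yb
      · have ho := S.out t ht htx hty
        refine ⟨by rintro rfl; exact ho.1 hs, fun h => ?_⟩
        rcases S.n1 t ht htx hty s (Or.inl hs) h.symm with h' | h'
        · exact hsx h'
        · subst h'; exact hsa (yA hs)
  · intro s hs hsa hsx t ht hta htx
    have hsb : s ≠ b := by rintro rfl; exact S.bA hs
    simp at ht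
    have hB : t ∈ B.support → s ≠ t ∧ ¬ G.Adj s t := fun h => hdAB s hs hsx t h htx
    rcases ht with ht | ht
    · by_cases htb : t = b
      · subst htb; exact hB B.end_mem_support
      · exact S.d13 s (Or.inl hs) hsa hsb t ht hta htb
    · exact hB ht
  · intro s hs hsa hsx t ht hta htx
    simp at hs ht
    have key : s ∈ C.support ∨ (s ∈ W.support ∧ s ≠ y) := by
      rcases hs with h | h
      · exact Or.inl h
      · by_cases hsy : s = y
        · subst hsy; exact Or.inl C.end_mem_support
        · exact Or.inr ⟨h, hsy⟩
    rcases key with hs | ⟨hs, hsy⟩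
    · have hsb : s ≠ b := by rintro rfl; exact bC hs
      by_cases htb : t = b
      · subst htb; exact ⟨hsb, nCb s hs⟩
      rcases ht with ht | ht
      · exact S.d23 s (hC _ hs) hsa hsb t ht hta htb
      · have := S.d12 t (Or.inr ht) hta htb s (hC _ hs) hsa hsb
        exact ⟨this.1.symm, fun h => this.2 h.symm⟩
    · have ho := S.out s hs hsx hsy
      rcases ht with ht | ht
      · refine ⟨by rintro rfl; exact ho.2.2.2 ht, fun h => ?_⟩
        rcases S.n2 s hs hsx hsy t (Or.inr ht) h with h' | h'
        · subst h'; exact hta (yQ3 ht)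
        · exact hno s hs ⟨hsx, hsy, t, ht, h, h'⟩
      · refine ⟨by rintro rfl; exact ho.2.1 ht, fun h => ?_⟩
        rcases S.n1 s hs hsx hsy t (Or.inr ht) h with h' | h'
        · exact htx h'
        · subst h'; exact S.yB ht

lemma final (S : Setup A B Q₂ Q₃ W) (hF : MemF 2 G) :
    ∃ R₂ R₃ : G.Walk a x, ThetaCfg G A R₂ R₃ := by
  by_cases hya : y = a
  · subst hya
    by_cases h : ∃ s ∈ W.support, Con b x y Q₃ s
    · obtain ⟨s, hs, h3⟩ := h
      exact S.swap.theta Q₃.start_mem_support (fun t ht h2 => S.both hF ht hs h2 h3)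
    · push Not at h
      exact S.theta Q₂.start_mem_support h
  · rcases S.yQ with hy | hy
    · exact S.theta hy (fun s hs h => S.no3 hF hy hya hs h)
    · exact S.swap.theta hy (fun s hs h => S.swap.no3 hF hy hya hs h)

end Setup



/-- A connecting walk avoiding the neighbourhoods of `b` and `v`. -/
def Conn (G : SimpleGraph V) (b v : V) (X Y : V → Prop) (n : ℕ) : Prop :=
  ∃ (x y : V) (W : G.Walk x y), X x ∧ Y y ∧ W.length = n ∧
    ∀ s ∈ W.support, s ≠ x → s ≠ y → s ≠ b ∧ ¬ G.Adj s b ∧ s ≠ v ∧ ¬ G.Adj s v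

lemma exists_min_conn {b v : V} {X Y : V → Prop} (h : ∃ n, Conn G b v X Y n) :
    ∃ (x y : V) (W : G.Walk x y), X x ∧ Y y ∧ IsIPath G W ∧
      (∀ s ∈ W.support, s ≠ x → s ≠ y → s ≠ b ∧ ¬ G.Adj s b ∧ s ≠ v ∧ ¬ G.Adj s v) ∧
      ∀ (x' y' : V) (W' : G.Walk x' y'), X x' → Y y' →
        (∀ s ∈ W'.support, s ≠ x' → s ≠ y' → s ∈ W.support ∧ s ≠ x ∧ s ≠ y) →
        W.length ≤ W'.length := by
  classical
  obtain ⟨x, y, W, hx, hy, hl, hW⟩ := Nat.find_spec h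
  obtain ⟨W1, h1, h2, h3⟩ := exists_ipath_s14 W
  refine ⟨x, y, W1, hx, hy, h1, fun s hs => hW s (h3 s hs), ?_⟩
  intro x' y' W' hx' hy' hW'
  refine h2.trans (hl.le.trans (Nat.find_min' h ⟨x', y', W', hx', hy', rfl, ?_⟩))
  intro s hs hsx hsy
  have := hW' s hs hsx hsy
  exact hW s (h3 s this.1) this.2.1 this.2.2

lemma min_props {b v : V} {X Y : V → Prop} {x y : V} {W : G.Walk x y} (hx : X x) (hy : Y y)
    (hW : IsIPath G W)
    (hmin : ∀ (x' y' : V) (W' : G.Walk x' y'), X x' → Y y' →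
        (∀ s ∈ W'.support, s ≠ x' → s ≠ y' → s ∈ W.support ∧ s ≠ x ∧ s ≠ y) →
        W.length ≤ W'.length) {r : V} (hr : r ∈ W.support) (hrx : r ≠ x) (hry : r ≠ y) :
    ¬ X r ∧ ¬ Y r ∧ (∀ t, X t → G.Adj r t → G.Adj r x) ∧
      (∀ t, Y t → G.Adj r t → G.Adj r y) := by
  obtain ⟨W1, W2, rfl⟩ := Walk.mem_support_iff_exists_append.1 hr
  have hp := ((path_append_iff W1 W2).1 ((ipath_iff_s14 _).1 hW).1).2.2
  have hx2 : x ∉ W2.support := fun h => hrx (hp x W1.start_mem_support h).symm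
  have hy1 : y ∉ W1.support := fun h => hry (hp y h W2.end_mem_support).symm
  have l1 : 0 < W1.length := len_pos W1 hrx.symm
  have l2 : 0 < W2.length := len_pos W2 hry
  refine ⟨fun h => ?_, fun h => ?_, fun t ht hrt => ?_, fun t ht hrt => ?_⟩
  · have := hmin r y W2 h hy (by
      intro s hs h1 h2
      exact ⟨by simp [hs], by rintro rfl; exact hx2 hs, h2⟩)
    simp only [Walk.length_append] at this; omega
  · have := hmin x r W1 hx h (by
      intro s hs h1 h2
      exact ⟨by simp [hs], h1, by rintro rfl; exact hy1 hs⟩)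
    simp only [Walk.length_append] at this; omega
  · have := hmin t y (Walk.cons hrt.symm W2) ht hy (by
      intro s hs h1 h2
      have hs : s ∈ W2.support := by simpa [h1] using hs
      exact ⟨by simp [hs], by rintro rfl; exact hx2 hs, h2⟩)
    simp at this
    have h1 : W1.length = 1 := by omega
    exact (Walk.adj_of_length_eq_one h1).symm
  · have := hmin x t (W1.append (Walk.cons hrt Walk.nil)) hx ht (by
      intro s hs h1 h2
      have hs : s ∈ W1.support := by
        rcases (by simpa [h2] using hs : s ∈ W1.support ∨ s = r) with h | rfl
        · exact h
        · exact W1.end_mem_support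
      exact ⟨by simp [hs], h1, by rintro rfl; exact hy1 hs⟩)
    simp at this
    have h1 : W2.length = 1 := by omega
    exact Walk.adj_of_length_eq_one h1

lemma theta_unique (hF : MemF 2 G) {a b : V} {Q₁ Q₂ Q₃ : G.Walk a b}
    (hT : ThetaCfg G Q₁ Q₂ Q₃) {r : V} (h1 : r ∉ Q₁.support) (h2 : r ∉ Q₂.support)
    (h3 : r ∉ Q₃.support) {s t : V} (hs : s ∈ Q₁.support ∨ s ∈ Q₂.support ∨ s ∈ Q₃.support)
    (ht : t ∈ Q₁.support ∨ t ∈ Q₂.support ∨ t ∈ Q₃.support)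
    (hrs : G.Adj r s) (hrt : G.Adj r t) : s = t := by
  obtain ⟨-, i1, i2, i3, l1, l2, l3, d12, d13, d23⟩ := hT
  have c12 := fun hs ht => sparse_two hF Q₁ Q₂ i1 i2 l1 l2 d12 h1 h2 hs ht hrs hrt
  have c13 := fun hs ht => sparse_two hF Q₁ Q₃ i1 i3 l1 l3 d13 h1 h3 hs ht hrs hrt
  have c23 := fun hs ht => sparse_two hF Q₂ Q₃ i2 i3 l2 l3 d23 h2 h3 hs ht hrs hrt
  tauto

lemma main_aux (hF : MemF 2 G)
    {a v₁ u₁ b : V} (h1 : G.Adj a v₁) (h2 : G.Adj v₁ u₁) (Q' : G.Walk u₁ b)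
    (Q₂ Q₃ : G.Walk a b) (hT : ThetaCfg G (Walk.cons h1 (Walk.cons h2 Q')) Q₂ Q₃)
    (hub : u₁ ≠ b)
    (hmin : ∀ (b' : V) (R₁ R₂ R₃ : G.Walk a b'), ThetaCfg G R₁ R₂ R₃ →
      [a, v₁, u₁] <+: R₁.support → (Walk.cons h1 (Walk.cons h2 Q')).length ≤ R₁.length)
    (z : V) (hz : z ∈ Q₂.support ∨ z ∈ Q₃.support) (hzb : z ≠ b) (hnzb : ¬ G.Adj z b)
    (P : G.Walk u₁ z)
    (hP : ∀ s ∈ P.support, s ≠ u₁ → s ≠ z → s ≠ b ∧ ¬ G.Adj s b ∧ s ≠ v₁ ∧ ¬ G.Adj s v₁) :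
    False := by
  obtain ⟨x, y, W, ⟨hxQ, hxb⟩, ⟨hyQ, hyb, hnyb⟩, iW, hW, hWmin⟩ :=
    exists_min_conn (G := G) (b := b) (v := v₁) (X := fun s => s ∈ Q'.support ∧ s ≠ b)
      (Y := fun s => (s ∈ Q₂.support ∨ s ∈ Q₃.support) ∧ s ≠ b ∧ ¬ G.Adj s b)
      ⟨_, u₁, z, P, ⟨Q'.start_mem_support, hub⟩, ⟨hz, hzb, hnzb⟩, rfl, hP⟩
  have hmp := fun r hr hrx hry => min_props (b := b) (v := v₁) (r := r) ⟨hxQ, hxb⟩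
    ⟨hyQ, hyb, hnyb⟩ iW hWmin hr hrx hry
  have hT' := hT
  obtain ⟨nab, i1, i2, i3, l1, l2, l3, d12, d13, d23⟩ := hT'
  obtain ⟨j1, aQ, nA⟩ := ipath_of_cons i1
  obtain ⟨j2, vQ, nV⟩ := ipath_of_cons j1
  have hab : a ≠ b := by
    rintro rfl
    exact aQ (by simp)
  have hvb : v₁ ≠ b := by
    rintro rfl
    exact nab h1
  have aQ' : a ∉ Q'.support := fun h => aQ (by simp [h])
  have xa : x ≠ a := by rintro rfl; exact aQ' hxQ
  have xv : x ≠ v₁ := by rintro rfl; exact vQ hxQ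
  have out : ∀ r ∈ W.support, r ≠ x → r ≠ y →
      r ∉ (Walk.cons h1 (Walk.cons h2 Q')).support ∧ r ∉ Q₂.support ∧ r ∉ Q₃.support := by
    intro r hr hrx hry
    obtain ⟨c1, c2, -, -⟩ := hmp r hr hrx hry
    obtain ⟨e1, e2, e3, e4⟩ := hW r hr hrx hry
    refine ⟨?_, fun h => c2 ⟨Or.inl h, e1, e2⟩, fun h => c2 ⟨Or.inr h, e1, e2⟩⟩
    intro h
    simp only [Walk.support_cons, List.mem_cons] at h
    rcases h with rfl | rfl | h
    · exact e4 h1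
    · exact e3 rfl
    · exact c1 ⟨h, e1⟩
  have hxT : x ∈ (Walk.cons h1 (Walk.cons h2 Q')).support := by simp [hxQ]
  have nY : ∀ r ∈ W.support, r ≠ x → r ≠ y → ∀ t, (t ∈ Q₂.support ∨ t ∈ Q₃.support) →
      G.Adj r t → t = y ∨ G.Adj t b := by
    intro r hr hrx hry t ht hrt
    by_cases htb : G.Adj t b
    · exact Or.inr htb
    obtain ⟨e1, e2, e3, e4⟩ := hW r hr hrx hry
    have htb' : t ≠ b := by rintro rfl; exact e2 hrt
    obtain ⟨o1, o2, o3⟩ := out r hr hrx hry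
    exact Or.inl (theta_unique hF hT o1 o2 o3 (Or.inr ht) (Or.inr hyQ) hrt
      ((hmp r hr hrx hry).2.2.2 t ⟨ht, htb', htb⟩ hrt))
  have nX : ∀ r ∈ W.support, r ≠ x → r ≠ y →
      ∀ t ∈ (Walk.cons h1 (Walk.cons h2 Q')).support, G.Adj r t → t = x ∨ t = y := by
    intro r hr hrx hry t ht hrt
    obtain ⟨e1, e2, e3, e4⟩ := hW r hr hrx hry
    obtain ⟨o1, o2, o3⟩ := out r hr hrx hry
    have ht' := ht
    simp only [Walk.support_cons, List.mem_cons] at ht'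
    rcases ht' with rfl | rfl | h
    · rcases nY r hr hrx hry t (by simp) hrt with h | h
      · exact Or.inr h
      · exact absurd h nab
    · exact absurd hrt e4
    · have htb' : t ≠ b := by rintro rfl; exact e2 hrt
      exact Or.inl (theta_unique hF hT o1 o2 o3 (Or.inl ht) (Or.inl hxT) hrt
        ((hmp r hr hrx hry).2.2.1 t ⟨h, htb'⟩ hrt))
  have nax : ¬ G.Adj a x := nA x (by simp [hxQ]) xv
  obtain ⟨A', B, rfl⟩ := Walk.mem_support_iff_exists_append.1 hxQ
  have hsub : ∀ s, (s ∈ (Walk.cons h1 (Walk.cons h2 A')).support ∨ s ∈ B.support) →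
      s ∈ (Walk.cons h1 (Walk.cons h2 (A'.append B))).support := by
    intro s hs
    simp at hs ⊢
    tauto
  have S : Setup (Walk.cons h1 (Walk.cons h2 A')) B Q₂ Q₃ W :=
    { nab := nab
      i1 := by simpa using i1
      i2 := i2
      i3 := i3
      d12 := fun s hs => d12 s (hsub s hs)
      d13 := fun s hs => d13 s (hsub s hs)
      d23 := d23
      xa := xa
      xb := hxb
      nax := nax
      iW := iW
      yb := hyb
      nyb := hnyb
      yQ := hyQ
      out := fun r hr hrx hry =>
        have o := out r hr hrx hry
        ⟨fun h => o.1 (hsub r (Or.inl h)), fun h => o.1 (hsub r (Or.inr h)), o.2⟩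
      n1 := fun r hr hrx hry t ht => nX r hr hrx hry t (hsub t ht)
      n2 := nY }
  obtain ⟨R₂, R₃, hR⟩ := S.final hF
  have := hmin x _ R₂ R₃ hR (by
    cases A' <;> simp)
  have hB := len_pos B hxb
  simp only [Walk.length_cons, Walk.length_append] at this
  omega

end

/-- Lemma `nopaththeta`. -/
theorem statement14 {V : Type} [Fintype V] (G : SimpleGraph V) (hF : MemF 2 G)
    (a v₁ u₁ : V) (hsg : a ≠ u₁ ∧ G.Adj a v₁ ∧ G.Adj v₁ u₁ ∧ ¬G.Adj a u₁)
    (b : V) (Q₁ Q₂ Q₃ : G.Walk a b) (hT : ThetaCfg G Q₁ Q₂ Q₃)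
    (hpre : [a, v₁, u₁] <+: Q₁.support)
    (hmin : ∀ (b' : V) (R₁ R₂ R₃ : G.Walk a b'), ThetaCfg G R₁ R₂ R₃ →
      [a, v₁, u₁] <+: R₁.support → Q₁.length ≤ R₁.length)
    (z : V) (hz : z ∈ Q₂.support ∨ z ∈ Q₃.support) (hzb : z ∉ closedNbhd G b)
    (P : G.Walk u₁ z) (hP : IsIPath G P) :
    ∃ x ∈ P.support, x ≠ u₁ ∧ x ≠ z ∧ x ∈ closedNbhd G b ∪ closedNbhd G v₁ := by
  by_contra! hcon
  have hP' : ∀ s ∈ P.support, s ≠ u₁ → s ≠ z →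
      s ≠ b ∧ ¬ G.Adj s b ∧ s ≠ v₁ ∧ ¬ G.Adj s v₁ := by
    intro s hs h1 h2
    have := hcon s hs h1 h2
    simp [closedNbhd, G.adj_comm] at this
    simp [G.adj_comm]
    tauto
  have hzb' : z ≠ b ∧ ¬ G.Adj z b := by
    simp [closedNbhd] at hzb
    rw [G.adj_comm]
    tauto
  by_cases hub : u₁ = b
  · subst hub
    cases P with
    | nil => exact hzb'.1 rfl
    | @cons _ q _ h p =>
      have hq := hP' q (by simp) h.ne.symm (by rintro rfl; exact hzb'.2 h.symm)
      exact hq.2.1 h.symm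
  cases Q₁ with
  | nil => simp at hpre
  | @cons _ v' _ h1 p =>
    cases p with
    | nil => simp at hpre
    | @cons _ u' _ h2 Q' =>
      have hv : v₁ = v' ∧ u₁ = u' := by
        cases Q' <;> simp at hpre <;> tauto
      obtain ⟨rfl, rfl⟩ := hv
      exact main_aux hF h1 h2 Q' Q₂ Q₃ hT hub hmin z hz hzb'.1 hzb'.2 P hP'

end Paper
end
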